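/- arXiv:1807.06170 — 10 statements merged into one kernel-verified Lean document; each statement's English description precedes it below -/
import Mathlib

section
/- Let P ⊆ ℝ^m (m ≥ 1) be a compact convex set that contains a closed Euclidean ball of radius r > 0, and let A be a proper subset of P such that every closed Euclidean ball contained in A has radius at most t ≥ 0. Let D ≥ 0 satisfy ‖p − q‖₂ ≤ D for all p, q ∈ P. If γ > D·t/r, then for every x ∈ A there exists y ∈ P \ A with ‖x − y‖₂ ≤ γ. -/
/-- If `P ⊆ ℝ^m` is a compact convex set containing a closed ball of radius
`r > 0`, `A ⊊ P` has thickness at most `t` (every closed ball contained in `A` has radius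
at most `t`), `D` bounds the diameter of `P`, and `γ > D·t/r`, then every point of `A`
is within distance `γ` of a point of `P \ A`. -/
theorem cones_nets (m : ℕ) (hm : 1 ≤ m)
    (P A : Set (EuclideanSpace ℝ (Fin m)))
    (hPcompact : IsCompact P) (hPconv : Convex ℝ P)
    (r : ℝ) (hr : 0 < r) (c : EuclideanSpace ℝ (Fin m))
    (hball : Metric.closedBall c r ⊆ P)
    (hAP : A ⊆ P) (hAne : A ≠ P)
    (t : ℝ) (ht : 0 ≤ t)
    (hthick : ∀ (z : EuclideanSpace ℝ (Fin m)) (ρ : ℝ), 0 ≤ ρ →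
      Metric.closedBall z ρ ⊆ A → ρ ≤ t)
    (D : ℝ) (hD : 0 ≤ D) (hdiam : ∀ p ∈ P, ∀ q ∈ P, dist p q ≤ D)
    (γ : ℝ) (hγ : D * t / r < γ) :
    ∀ x ∈ A, ∃ y ∈ P \ A, dist x y ≤ γ := by
  intro x hx
  by_contra! hfar
  have hnear : ∀ y ∈ P, dist x y ≤ γ → y ∈ A := fun y hy hxy => by
    by_contra hyA
    exact absurd hxy (not_le.2 (hfar y ⟨hy, hyA⟩))
  have hγ0 : 0 < γ := lt_of_le_of_lt (by positivity) hγ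
  have hγD : γ < D := by
    by_contra! hle
    exact hAne (hAP.antisymm fun y hy => hnear y hy ((hdiam x (hAP hx) y hy).trans hle))
  have hD0 : 0 < D := hγ0.trans hγD
  obtain ⟨s, hs⟩ : ∃ s, s = γ / D := ⟨_, rfl⟩
  have hs0 : 0 < s := hs ▸ div_pos hγ0 hD0
  have hs1 : s < 1 := hs ▸ (div_lt_one hD0).2 hγD
  have hsD : s * D = γ := by rw [hs]; field_simp
  -- The homothety of ratio `s` centred at `x` maps the ball in `P` to a ball in `A`.
  have hsub : Metric.closedBall (x + s • (c - x)) (s * r) ⊆ A := by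
    intro w hw
    obtain ⟨p, hp⟩ : ∃ p, p = x + s⁻¹ • (w - x) := ⟨_, rfl⟩
    have hw_eq : w - x = s • (p - x) := by
      rw [hp, add_sub_cancel_left, smul_inv_smul₀ hs0.ne']
    have hpP : p ∈ P := by
      apply hball
      rw [Metric.mem_closedBall, dist_eq_norm] at hw ⊢
      have h : w - (x + s • (c - x)) = s • (p - c) := by
        rw [← sub_sub, hw_eq, ← smul_sub, sub_sub_sub_cancel_right]
      rw [h, norm_smul, Real.norm_of_nonneg hs0.le] at hw
      exact le_of_mul_le_mul_left hw hs0
    have hwP : w ∈ P := by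
      have h := hPconv.add_smul_sub_mem (hAP hx) hpP ⟨hs0.le, hs1.le⟩
      rwa [← hw_eq, add_sub_cancel] at h
    refine hnear w hwP ?_
    rw [dist_comm, dist_eq_norm, hw_eq, norm_smul, Real.norm_of_nonneg hs0.le, ← hsD]
    exact mul_le_mul_of_nonneg_left (dist_eq_norm p x ▸ hdiam p hpP x (hAP hx)) hs0.le
  have hle := hthick _ (s * r) (by positivity) hsub
  rw [div_lt_iff₀ hr, ← hsD] at hγ
  nlinarith [mul_le_mul_of_nonneg_left hle hD]
end

section
/- Let m ≥ 1 and let Δ^m = {x ∈ ℝ^m : x_i ≥ 0 for all i, Σ_i x_i ≤ 1}. Suppose A ⊆ Δ^m with A ≠ Δ^m and suppose every closed Euclidean ball contained in A has radius at most ε ≥ 0. Then for every γ > √2·(m + √m)·ε and every x ∈ A, there exists y ∈ Δ^m \ A with ‖x − y‖₂ ≤ γ. In particular the conclusion holds for every γ > 4mε. -/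
/-- The unit simplex `Δ^m = {x ∈ ℝ^m : ∀ i, x i ≥ 0, ∑ i, x i ≤ 1}` viewed inside
Euclidean space. -/
def unitSimplex (m : ℕ) : Set (EuclideanSpace ℝ (Fin m)) :=
  {x | (∀ i, 0 ≤ x i) ∧ ∑ i, x i ≤ 1}

theorem unitSimplex.dist_le_sqrt_two {m : ℕ} {x y : EuclideanSpace ℝ (Fin m)}
    (hx : x ∈ unitSimplex m) (hy : y ∈ unitSimplex m) : dist x y ≤ Real.sqrt 2 := by
  have sq_le {z : EuclideanSpace ℝ (Fin m)} (hz : z ∈ unitSimplex m) (i : Fin m) :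
      z i ^ 2 ≤ z i := by
    have hle : z i ≤ 1 :=
      (Finset.single_le_sum (fun j _ => hz.1 j) (Finset.mem_univ i)).trans hz.2
    nlinarith [hz.1 i]
  rw [EuclideanSpace.dist_eq]
  apply Real.sqrt_le_sqrt
  calc ∑ i, dist (x i) (y i) ^ 2 ≤ ∑ i, (x i + y i) := by
        refine Finset.sum_le_sum fun i _ => ?_
        rw [Real.dist_eq, sq_abs]
        nlinarith [sq_le hx i, sq_le hy i, mul_nonneg (hx.1 i) (hy.1 i)]
    _ ≤ 2 := by
        rw [Finset.sum_add_distrib]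
        linarith [hx.2, hy.2]

theorem convex_unitSimplex (m : ℕ) : Convex ℝ (unitSimplex m) := by
  intro x hx y hy a b ha hb hab
  refine ⟨fun i => ?_, ?_⟩
  · simpa using add_nonneg (mul_nonneg ha (hx.1 i)) (mul_nonneg hb (hy.1 i))
  · simp only [PiLp.add_apply, PiLp.smul_apply, smul_eq_mul, Finset.sum_add_distrib,
      ← Finset.mul_sum]
    nlinarith [mul_le_mul_of_nonneg_left hx.2 ha, mul_le_mul_of_nonneg_left hy.2 hb]

/-- The simplex contains a ball of radius `1 / (m + √m)`, centred at the point all of whose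
coordinates equal this radius. -/
theorem closedBall_subset_unitSimplex {m : ℕ} (hm : 1 ≤ m) :
    Metric.closedBall (WithLp.toLp 2 fun _ : Fin m => ((m : ℝ) + Real.sqrt m)⁻¹)
      ((m : ℝ) + Real.sqrt m)⁻¹ ⊆ unitSimplex m := by
  have hm' : (0 : ℝ) < m := by exact_mod_cast hm
  have hpos : 0 < (m : ℝ) + Real.sqrt m := by positivity
  set r : ℝ := ((m : ℝ) + Real.sqrt m)⁻¹
  have hr0 : 0 < r := inv_pos.mpr hpos
  intro y hy
  rw [Metric.mem_closedBall, EuclideanSpace.dist_eq, Real.sqrt_le_left hr0.le] at hy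
  simp only [Real.dist_eq, sq_abs] at hy
  refine ⟨fun i => ?_, ?_⟩
  · have h := (Finset.single_le_sum (f := fun j => (y j - r) ^ 2)
      (fun j _ => sq_nonneg _) (Finset.mem_univ i)).trans hy
    linarith [(abs_le_of_sq_le_sq' h hr0.le).1]
  · have h : (∑ i, (y i - r)) ^ 2 ≤ (Real.sqrt m * r) ^ 2 := by
      have hcs := sq_sum_le_card_mul_sum_sq (s := Finset.univ) (f := fun i => y i - r)
      rw [Finset.card_univ, Fintype.card_fin] at hcs
      rw [mul_pow, Real.sq_sqrt hm'.le]
      exact hcs.trans (mul_le_mul_of_nonneg_left hy hm'.le)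
    have h' := abs_le_of_sq_le_sq' h (by positivity)
    have hone : ((m : ℝ) + Real.sqrt m) * r = 1 := mul_inv_cancel₀ hpos.ne'
    rw [Finset.sum_sub_distrib, Finset.sum_const, Finset.card_univ, Fintype.card_fin,
      nsmul_eq_mul] at h'
    linarith [h'.2]

/-- If a convex set of diameter at most `D` contains a ball of radius `r`, then its
intersection with the ball of radius `t * D` around one of its points contains a ball of
radius `t * r`. -/
theorem Convex.closedBall_subset_inter_closedBall {E : Type*} [NormedAddCommGroup E]
    [NormedSpace ℝ E] {S : Set E} (hS : Convex ℝ S) {D r t : ℝ} {c x : E}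
    (hdiam : ∀ y ∈ S, dist x y ≤ D) (hc : Metric.closedBall c r ⊆ S) (hx : x ∈ S)
    (ht0 : 0 < t) (ht1 : t ≤ 1) :
    Metric.closedBall (x + t • (c - x)) (t * r) ⊆ S ∩ Metric.closedBall x (t * D) := by
  intro y hy
  obtain ⟨z, rfl⟩ : ∃ z, y = x + t • (z - x) :=
    ⟨x + t⁻¹ • (y - x), by simp [smul_smul, ht0.ne']⟩
  have hz : z ∈ S := by
    apply hc
    rw [Metric.mem_closedBall, dist_add_left, dist_smul₀, dist_sub_right,
      Real.norm_of_nonneg ht0.le] at hy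
    exact le_of_mul_le_mul_left hy ht0
  refine ⟨hS.add_smul_sub_mem hx hz ⟨ht0.le, ht1⟩, ?_⟩
  rw [Metric.mem_closedBall, dist_self_add_left, norm_smul, Real.norm_of_nonneg ht0.le,
    ← dist_eq_norm, dist_comm]
  exact mul_le_mul_of_nonneg_left (hdiam z hz) ht0.le

/-- If `A ⊊ Δ^m` has thickness at most `ε` (every closed ball contained in
`A` has radius at most `ε`), then for every `γ > √2·(m + √m)·ε` every point of `A` is
within Euclidean distance `γ` of a point of `Δ^m \ A`; in particular this holds for every
`γ > 4mε`. -/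
theorem thickness_to_distance (m : ℕ) (hm : 1 ≤ m)
    (A : Set (EuclideanSpace ℝ (Fin m)))
    (hA : A ⊆ unitSimplex m) (hAne : A ≠ unitSimplex m)
    (ε : ℝ) (hε : 0 ≤ ε)
    (hthick : ∀ (c : EuclideanSpace ℝ (Fin m)) (ρ : ℝ), 0 ≤ ρ →
      Metric.closedBall c ρ ⊆ A → ρ ≤ ε) :
    (∀ γ : ℝ, Real.sqrt 2 * ((m : ℝ) + Real.sqrt m) * ε < γ →
      ∀ x ∈ A, ∃ y ∈ unitSimplex m \ A, dist x y ≤ γ) ∧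
    (∀ γ : ℝ, 4 * (m : ℝ) * ε < γ →
      ∀ x ∈ A, ∃ y ∈ unitSimplex m \ A, dist x y ≤ γ) := by
  have hm' : (1 : ℝ) ≤ m := by exact_mod_cast hm
  have hpos : 0 < (m : ℝ) + Real.sqrt m := by positivity
  have h2 : 0 < Real.sqrt 2 := by positivity
  have main : ∀ γ : ℝ, Real.sqrt 2 * ((m : ℝ) + Real.sqrt m) * ε < γ →
      ∀ x ∈ A, ∃ y ∈ unitSimplex m \ A, dist x y ≤ γ := by
    intro γ hγ x hx
    by_contra! hfar
    have hsub : unitSimplex m ∩ Metric.closedBall x γ ⊆ A := fun y hy => by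
      by_contra hyA
      exact (hfar y ⟨hy.1, hyA⟩).not_ge (by rw [dist_comm]; exact hy.2)
    have hdiam : ∀ y ∈ unitSimplex m, dist x y ≤ Real.sqrt 2 := fun y hy =>
      unitSimplex.dist_le_sqrt_two (hA hx) hy
    rcases le_total (Real.sqrt 2) γ with hle | hle
    · refine hAne (hA.antisymm fun y hy => hsub ⟨hy, ?_⟩)
      rw [Metric.mem_closedBall, dist_comm]
      exact (hdiam y hy).trans hle
    · have hγ0 : 0 < γ := lt_of_le_of_lt (by positivity) hγ
      have hball := (convex_unitSimplex m).closedBall_subset_inter_closedBall hdiam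
        (closedBall_subset_unitSimplex hm) (hA hx) (div_pos hγ0 h2) ((div_le_one h2).mpr hle)
      rw [div_mul_cancel₀ _ h2.ne'] at hball
      have hρ := hthick _ _ (by positivity) (hball.trans hsub)
      rw [← div_eq_mul_inv, div_div, div_le_iff₀ (by positivity)] at hρ
      linarith
  refine ⟨main, fun γ hγ => main γ (lt_of_le_of_lt ?_ hγ)⟩
  have hsqrt : Real.sqrt m ≤ m := Real.sqrt_le_self_iff.mpr (Or.inr hm')
  have hsqrt2 : Real.sqrt 2 ≤ 2 := Real.sqrt_le_self_iff.mpr (Or.inr one_le_two)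
  apply mul_le_mul_of_nonneg_right _ hε
  calc Real.sqrt 2 * ((m : ℝ) + Real.sqrt m) ≤ 2 * ((m : ℝ) + m) := by gcongr
    _ = 4 * m := by ring
end

section
/- Let P_1, ..., P_k ⊆ ℝ^m (m ≥ 1) be compact convex sets, and let t_1, ..., t_k ≥ 0 be such that every closed Euclidean ball contained in P_i has radius at most t_i, for each i. If R > (10/3)·(Σ_i t_i)·(m+1)^{3/2} and R > 0, then for every x ∈ ℝ^m the closed Euclidean ball of radius R centered at x is not contained in P_1 ∪ ... ∪ P_k. (Equivalently, the thickness of the union is less than (10/3)·(Σ_i t_i)·(m+1)^{3/2} whenever this quantity is positive.) -/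
/-- **Bang's lemma**: open slabs `{x | |⟪x, a i⟫ - c i| < ‖a i‖ ^ 2}`, of half-widths `‖a i‖`,
never cover the centered closed ball of radius `∑ i, ‖a i‖`. -/
theorem exists_norm_le_forall_sq_norm_le_abs_inner_sub {ι E : Type*} [Fintype ι]
    [NormedAddCommGroup E] [InnerProductSpace ℝ E] (a : ι → E) (c : ι → ℝ) :
    ∃ x : E, ‖x‖ ≤ ∑ i, ‖a i‖ ∧ ∀ i, ‖a i‖ ^ 2 ≤ |inner ℝ x (a i) - c i| := by
  classical
  let sgn : ℤˣ → ℝ := fun e ↦ ((e : ℤ) : ℝ)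
  have hsgn : ∀ e : ℤˣ, sgn e = 1 ∨ sgn e = -1 := fun e ↦ by
    rcases Int.units_eq_one_or e with rfl | rfl <;> simp [sgn]
  let y : (ι → ℤˣ) → E := fun ε ↦ ∑ i, sgn (ε i) • a i
  obtain ⟨ε, hε⟩ := Finite.exists_max fun ε ↦ ‖y ε‖ ^ 2 - 2 * ∑ i, sgn (ε i) * c i
  refine ⟨y ε, (norm_sum_le _ _).trans (Finset.sum_le_sum fun i _ ↦ ?_), fun i ↦ ?_⟩
  · rcases hsgn (ε i) with h | h <;> simp [h]
  · have hflip := hε (Function.update ε i (-ε i))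
    have hy : y (Function.update ε i (-ε i)) = y ε - (2 * sgn (ε i)) • a i := by
      simp only [y]
      rw [← Finset.add_sum_erase _ _ (Finset.mem_univ i),
        ← Finset.add_sum_erase (a := i) _ (fun j ↦ sgn (ε j) • a j) (Finset.mem_univ i),
        Finset.sum_congr rfl fun j hj ↦ by
          rw [Function.update_of_ne (Finset.ne_of_mem_erase hj)]]
      simp only [Function.update_self, sgn, Units.val_neg, Int.cast_neg]
      module
    have hc : ∑ j, sgn (Function.update ε i (-ε i) j) * c j
        = ∑ j, sgn (ε j) * c j - 2 * sgn (ε i) * c i := by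
      rw [← Finset.add_sum_erase _ _ (Finset.mem_univ i),
        ← Finset.add_sum_erase (a := i) _ (fun j ↦ sgn (ε j) * c j) (Finset.mem_univ i),
        Finset.sum_congr rfl fun j hj ↦ by
          rw [Function.update_of_ne (Finset.ne_of_mem_erase hj)]]
      simp only [Function.update_self, sgn, Units.val_neg, Int.cast_neg]
      ring
    rw [hy, hc, norm_sub_sq_real, norm_smul, inner_smul_right, mul_pow, Real.norm_eq_abs,
      sq_abs] at hflip
    rcases hsgn (ε i) with h | h <;> rw [h] at hflip
    · exact le_trans (by linarith) (le_abs_self _)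
    · exact le_trans (by linarith) (neg_le_abs _)

/-- **Minkowski's asymmetry bound**: a nonempty compact convex set `P` in dimension `d` has a
point `g` such that the reflection of `P - g`, shrunk by the factor `d`, lies in `P - g`. -/
theorem exists_forall_exists_finrank_add_one_smul_eq {E : Type*} [NormedAddCommGroup E]
    [InnerProductSpace ℝ E] [FiniteDimensional ℝ E] (hd : 0 < Module.finrank ℝ E) {P : Set E}
    (hne : P.Nonempty) (hcomp : IsCompact P) (hconv : Convex ℝ P) :
    ∃ g : E, ∀ x ∈ P, ∃ q ∈ P,
      ((Module.finrank ℝ E : ℝ) + 1) • g = x + (Module.finrank ℝ E : ℝ) • q := by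
  classical
  set d := Module.finrank ℝ E with hd_def
  have hd' : (0 : ℝ) < d := by exact_mod_cast hd
  have hd1 : ((d : ℝ) + 1) ≠ 0 := by positivity
  have : Nonempty P := hne.to_subtype
  -- Indexing by `P × ℕ` repeats every set, so that Helly's theorem applies even to small `P`.
  let F : P × ℕ → Set E := fun p ↦
    (fun q : E ↦ ((d : ℝ) + 1)⁻¹ • ((d : ℝ) • q + (p.1 : E))) '' P
  obtain ⟨g, hg⟩ : (⋂ p, F p).Nonempty := by
    refine Convex.helly_theorem_compact (𝕜 := ℝ) (F := F) (by simp) (fun p ↦ ?_) (fun p ↦ ?_)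
      (fun I hI ↦ ?_)
    · have h := ((hconv.smul (d : ℝ)).translate (p.1 : E)).smul ((d : ℝ) + 1)⁻¹
      simp only [← Set.image_smul, Set.image_image] at h
      simpa only [F, add_comm] using h
    · exact hcomp.image (by fun_prop)
    · refine ⟨((d : ℝ) + 1)⁻¹ • ∑ p ∈ I, (p.1 : E), Set.mem_iInter₂.2 fun p hp ↦ ?_⟩
      refine ⟨∑ j ∈ I.erase p, (d : ℝ)⁻¹ • (j.1 : E), hconv.sum_mem (fun _ _ ↦ by positivity) ?_
        (fun j _ ↦ j.1.2), ?_⟩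
      · rw [Finset.sum_const, Finset.card_erase_of_mem hp, hI, nsmul_eq_mul]
        simp [← hd_def, hd'.ne']
      · simp only [← Finset.smul_sum]
        rw [smul_inv_smul₀ hd'.ne', Finset.sum_erase_add _ _ hp]
  refine ⟨g, fun x hx ↦ ?_⟩
  obtain ⟨q, hq, rfl⟩ := Set.mem_iInter.1 hg (⟨x, hx⟩, 0)
  exact ⟨q, hq, by rw [smul_inv_smul₀ hd1, add_comm]⟩

open scoped Pointwise in
/-- A compact convex set all of whose closed balls have radius at most `t` lies in an open slab
of width at most `W`, for every `W > (d + 1) t`, where `d` is the dimension. -/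
theorem exists_forall_abs_inner_sub_lt_sq_norm {E : Type*} [NormedAddCommGroup E]
    [InnerProductSpace ℝ E] [FiniteDimensional ℝ E] (hd : 0 < Module.finrank ℝ E) {P : Set E}
    (hcomp : IsCompact P) (hconv : Convex ℝ P) {t W : ℝ}
    (ht : ∀ (c : E) (ρ : ℝ), 0 ≤ ρ → Metric.closedBall c ρ ⊆ P → ρ ≤ t)
    (hW : 0 < W) (htW : ((Module.finrank ℝ E : ℝ) + 1) * t < W) :
    ∃ (a : E) (c : ℝ), ‖a‖ ≤ W / 2 ∧ ∀ x ∈ P, |inner ℝ x a - c| < ‖a‖ ^ 2 := by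
  rcases P.eq_empty_or_nonempty with rfl | hne
  · exact ⟨0, 0, by simpa using (half_pos hW).le, by simp⟩
  obtain ⟨g, hg⟩ := exists_forall_exists_finrank_add_one_smul_eq hd hne hcomp hconv
  set d := Module.finrank ℝ E
  have hd1 : (0 : ℝ) < (d : ℝ) + 1 := by positivity
  obtain ⟨v, hvW, hv⟩ : ∃ v : E, ‖v‖ ≤ W ∧ v ∉ P - P := by
    by_contra! hball
    have hsub : Metric.closedBall g (W / (d + 1)) ⊆ P := by
      intro z hz
      rw [mem_closedBall_iff_norm, le_div_iff₀ hd1] at hz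
      obtain ⟨p, hp, q, hq, hpq⟩ := Set.mem_sub.1 <| hball (((d : ℝ) + 1) • (z - g)) (by
        rw [norm_smul, Real.norm_of_nonneg hd1.le]; linarith)
      obtain ⟨r, hr, hgr⟩ := hg q hq
      have hz' : z = ((d : ℝ) + 1)⁻¹ • p + ((d : ℝ) / (d + 1)) • r := by
        rw [eq_comm, ← sub_eq_zero, ← smul_eq_zero_iff_right hd1.ne']
        have h1 : ((d : ℝ) + 1) • (((d : ℝ) + 1)⁻¹ • p + ((d : ℝ) / (d + 1)) • r - z)
            = p + (d : ℝ) • r - ((d : ℝ) + 1) • z := by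
          rw [smul_sub, smul_add, smul_inv_smul₀ hd1.ne', smul_smul, mul_div_cancel₀ _ hd1.ne']
        have h2 : ((d : ℝ) + 1) • z = p - q + (q + (d : ℝ) • r) := by
          rw [hpq, ← hgr]; module
        rw [h1, h2]; abel
      rw [hz']
      exact hconv hp hr (by positivity) (by positivity) (by field_simp; ring)
    have := ht g _ (by positivity) hsub
    rw [div_le_iff₀ hd1] at this
    linarith
  obtain ⟨f, b, hfb, hbv⟩ := geometric_hahn_banach_closed_point (hconv.sub hconv)
    (sub_eq_add_neg P P ▸ hcomp.add hcomp.neg).isClosed hv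
  obtain ⟨u, rfl⟩ := (InnerProductSpace.toDual ℝ E).surjective f
  simp only [InnerProductSpace.toDual_apply_apply] at hfb hbv
  have hcont : Continuous fun x : E ↦ inner ℝ u x := by fun_prop
  obtain ⟨p, hp, hmax⟩ := hcomp.exists_isMaxOn hne hcont.continuousOn
  obtain ⟨q, hq, hmin⟩ := hcomp.exists_isMinOn hne hcont.continuousOn
  have hgap := (hfb _ (Set.sub_mem_sub hp hq)).trans hbv
  rw [inner_sub_right] at hgap
  have hpos : 0 < inner ℝ u v := by linarith [isMaxOn_iff.1 hmax q hq]
  have hu : 0 < ‖u‖ := norm_pos_iff.2 fun h ↦ by simp [h] at hpos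
  obtain ⟨s, hs⟩ : ∃ s : ℝ, s = inner ℝ u v / (2 * ‖u‖ ^ 2) := ⟨_, rfl⟩
  have hs0 : 0 < s := hs ▸ by positivity
  have hs' : inner ℝ u v = 2 * s * ‖u‖ ^ 2 := by rw [hs]; field_simp
  refine ⟨s • u, s * ((inner ℝ u p + inner ℝ u q) / 2), ?_, fun x hx ↦ ?_⟩
  · rw [norm_smul, Real.norm_of_nonneg hs0.le]
    have := real_inner_le_norm u v
    have : ‖u‖ * (2 * (s * ‖u‖)) ≤ ‖u‖ * ‖v‖ := by linarith
    linarith [le_of_mul_le_mul_left this hu]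
  · have h1 := isMaxOn_iff.1 hmax x hx
    have h2 := isMinOn_iff.1 hmin x hx
    rw [inner_smul_right, real_inner_comm, ← mul_sub, abs_mul, abs_of_pos hs0, norm_smul,
      Real.norm_of_nonneg hs0.le, mul_pow, sq s, mul_assoc]
    refine mul_lt_mul_of_pos_left ?_ hs0
    rw [abs_lt]
    constructor <;> linarith

/-- Sub-additivity of thickness for unions of convex sets: if each compact
convex `P i ⊆ ℝ^m` has thickness at most `t i` and
`R > (10/3)·(∑ i, t i)·(m+1)^{3/2}`, `R > 0`, then no closed ball of radius `R` is
contained in `⋃ i, P i`. -/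
theorem thickness_subadditive (m k : ℕ) (hm : 1 ≤ m)
    (P : Fin k → Set (EuclideanSpace ℝ (Fin m)))
    (hPcompact : ∀ i, IsCompact (P i)) (hPconv : ∀ i, Convex ℝ (P i))
    (t : Fin k → ℝ) (ht : ∀ i, 0 ≤ t i)
    (hthick : ∀ (i : Fin k) (c : EuclideanSpace ℝ (Fin m)) (ρ : ℝ), 0 ≤ ρ →
      Metric.closedBall c ρ ⊆ P i → ρ ≤ t i)
    (R : ℝ) (hR : 0 < R)
    (hR' : (10 / 3) * (∑ i, t i) * ((m : ℝ) + 1) ^ ((3 : ℝ) / 2) < R) :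
    ∀ x : EuclideanSpace ℝ (Fin m), ¬ Metric.closedBall x R ⊆ ⋃ i, P i := by
  intro x₀ hcover
  have hm1 : (1 : ℝ) ≤ (m : ℝ) + 1 := by simp
  have hk : (0 : ℝ) < (k : ℝ) + 1 := by positivity
  have hT : 0 ≤ ∑ i, t i := Finset.sum_nonneg fun i _ ↦ ht i
  have hTR : ((m : ℝ) + 1) * ∑ i, t i ≤ R := by
    have hpow : (m : ℝ) + 1 ≤ ((m : ℝ) + 1) ^ ((3 : ℝ) / 2) :=
      Real.self_le_rpow_of_one_le hm1 (by norm_num)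
    have hmul := mul_le_mul_of_nonneg_right hpow hT
    have hnn : 0 ≤ ((m : ℝ) + 1) ^ ((3 : ℝ) / 2) * ∑ i, t i := by positivity
    linarith
  have hδ : 0 < R / ((k : ℝ) + 1) := by positivity
  have hslab : ∀ i, ∃ (a : EuclideanSpace ℝ (Fin m)) (c : ℝ),
      ‖a‖ ≤ (((m : ℝ) + 1) * t i + R / (k + 1)) / 2 ∧
        ∀ x ∈ P i, |inner ℝ x a - c| < ‖a‖ ^ 2 := fun i ↦ by
    have hnn := mul_nonneg (zero_le_one.trans hm1) (ht i)
    exact exists_forall_abs_inner_sub_lt_sq_norm (by rw [finrank_euclideanSpace_fin]; omega) (hPcompact i) (hPconv i)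
      (hthick i) (by linarith) (by rw [finrank_euclideanSpace_fin]; linarith)
  choose a c ha hac using hslab
  obtain ⟨x, hx, hxa⟩ := exists_norm_le_forall_sq_norm_le_abs_inner_sub a
    fun i ↦ c i - inner ℝ x₀ (a i)
  have hsum : ∑ i, ‖a i‖ ≤ R := by
    refine (Finset.sum_le_sum fun i _ ↦ ha i).trans ?_
    rw [← Finset.sum_div, Finset.sum_add_distrib, ← Finset.mul_sum, Finset.sum_const,
      Finset.card_univ, Fintype.card_fin, nsmul_eq_mul]
    have : (k : ℝ) * (R / (k + 1)) ≤ R := by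
      rw [mul_div_assoc', div_le_iff₀ hk]; linarith
    linarith
  obtain ⟨i, hi⟩ := Set.mem_iUnion.1 <| hcover (show x₀ + x ∈ Metric.closedBall x₀ R by
    simpa using hx.trans hsum)
  have hin := hac i _ hi
  have hout := hxa i
  rw [inner_add_left] at hin
  rw [show inner ℝ x (a i) - (c i - inner ℝ x₀ (a i))
    = inner ℝ x₀ (a i) + inner ℝ x (a i) - c i by ring] at hout
  exact hout.not_gt hin
end

section
/- Let V ⊆ ℝ^m be a finite set, let P = conv(V) be its convex hull, and let π : ℝ^m → ℝ be the projection onto the first coordinate. Let x ≤ y be real numbers such that no point v ∈ V has π(v) ∈ [x, y]. Then conv( (P ∩ π^{-1}(x)) ∪ (P ∩ π^{-1}(y)) ) = P ∩ π^{-1}([x, y]); that is, the convex hull of the two cross-sections of P at first coordinate x and at first coordinate y equals the slice of P with first coordinate in [x, y]. -/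
/-- If a linear functional takes no value in `[x, y]` on `V`, then the part of the convex hull of
`V` lying over `[x, y]` is the convex hull of its parts over `x` and over `y`. -/
theorem convexHull_fibers_eq_convexHull_inter_slab {E : Type*} [AddCommGroup E] [Module ℝ E]
    (f : E →ₗ[ℝ] ℝ) {V : Set E} {x y : ℝ} (hxy : x ≤ y)
    (hV : ∀ v ∈ V, ¬ (x ≤ f v ∧ f v ≤ y)) :
    convexHull ℝ ((convexHull ℝ V ∩ {p | f p = x}) ∪ (convexHull ℝ V ∩ {p | f p = y})) =
      convexHull ℝ V ∩ {p | x ≤ f p ∧ f p ≤ y} := by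
  apply Set.Subset.antisymm
  · refine convexHull_min ?_ ((convex_convexHull ℝ V).inter ((convex_Icc x y).linear_preimage f))
    rintro p (⟨hp, rfl⟩ | ⟨hp, rfl⟩)
    · exact ⟨hp, le_rfl, hxy⟩
    · exact ⟨hp, hxy, le_rfl⟩
  rintro p ⟨hp, hxp, hpy⟩
  have below {q : E} (hq : q ∈ convexHull ℝ (V ∩ {v | f v < x})) : f q < x :=
    convexHull_min Set.inter_subset_right ((convex_Iio x).linear_preimage f) hq
  have above {q : E} (hq : q ∈ convexHull ℝ (V ∩ {v | y < f v})) : y < f q :=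
    convexHull_min Set.inter_subset_right ((convex_Ioi y).linear_preimage f) hq
  have hsplit : V = (V ∩ {v | f v < x}) ∪ (V ∩ {v | y < f v}) := by
    ext v
    have := hV v
    simp only [Set.mem_union, Set.mem_inter_iff, Set.mem_ofPred_eq]
    grind
  have hp' := hp
  rw [hsplit] at hp'
  rcases (V ∩ {v | f v < x}).eq_empty_or_nonempty with hA | hA
  · rw [hA, Set.empty_union] at hp'
    exact absurd (above hp') hpy.not_gt
  rcases (V ∩ {v | y < f v}).eq_empty_or_nonempty with hB | hB
  · rw [hB, Set.union_empty] at hp'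
    exact absurd (below hp') hxp.not_gt
  rw [convexHull_union hA hB, mem_convexJoin] at hp'
  obtain ⟨a, ha, b, hb, hpab⟩ := hp'
  have hax := below ha
  have hyb := above hb
  have haV := convexHull_mono Set.inter_subset_left ha
  have hbV := convexHull_mono Set.inter_subset_left hb
  rw [segment_eq_image_lineMap] at hpab
  obtain ⟨t, -, rfl⟩ := hpab
  have hd : 0 < f b - f a := by linarith
  have hf (s : ℝ) : f (AffineMap.lineMap a b s) = s * (f b - f a) + f a := by
    simp [AffineMap.lineMap_apply]
  have hmem {z : ℝ} (hz : x ≤ z) (hz' : z ≤ y) :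
      AffineMap.lineMap a b ((z - f a) / (f b - f a)) ∈ convexHull ℝ V ∩ {p | f p = z} := by
    refine ⟨(convex_convexHull ℝ V).lineMap_mem haV hbV
      ⟨div_nonneg (by linarith) hd.le, (div_le_one hd).2 (by linarith)⟩, ?_⟩
    rw [Set.mem_ofPred_eq, hf, div_mul_cancel₀ _ hd.ne', sub_add_cancel]
  refine segment_subset_convexHull (Set.mem_union_left _ (hmem le_rfl hxy))
    (Set.mem_union_right _ (hmem hxy le_rfl)) ?_
  rw [← image_segment]
  refine Set.mem_image_of_mem _ (Icc_subset_segment ⟨?_, ?_⟩)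
  · rw [div_le_iff₀ hd]
    linarith [hf t]
  · rw [le_div_iff₀ hd]
    linarith [hf t]


/-- Let `P = conv V` for a finite `V ⊆ ℝ^m` and let `π` be the projection
onto the first coordinate. If no `v ∈ V` has `π v ∈ [x, y]` (with `x ≤ y`), then the
convex hull of the two cross-sections of `P` at first coordinate `x` and `y` equals the
`[x,y]`-slice of `P`. -/
theorem hull_of_cross_sections_eq_slice (m : ℕ) (hm : 0 < m)
    (V : Set (Fin m → ℝ)) (hV : V.Finite)
    (x y : ℝ) (hxy : x ≤ y)
    (hcrit : ∀ v ∈ V, ¬ (x ≤ v ⟨0, hm⟩ ∧ v ⟨0, hm⟩ ≤ y)) :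
    convexHull ℝ
        ((convexHull ℝ V ∩ {p : Fin m → ℝ | p ⟨0, hm⟩ = x}) ∪
          (convexHull ℝ V ∩ {p : Fin m → ℝ | p ⟨0, hm⟩ = y})) =
      convexHull ℝ V ∩ {p : Fin m → ℝ | x ≤ p ⟨0, hm⟩ ∧ p ⟨0, hm⟩ ≤ y} := by
  exact convexHull_fibers_eq_convexHull_inter_slab
    (LinearMap.proj ⟨0, hm⟩ : (Fin m → ℝ) →ₗ[ℝ] ℝ) hxy hcrit
end

section
/- Let V ⊆ ℝ^m be a finite set, let P = conv(V), and let π : ℝ^m → ℝ be the projection onto the first coordinate. If x ∈ ℝ is not equal to π(v) for any v ∈ V, then the relative interior of the cross-section P ∩ π^{-1}(x) equals (relative interior of P) ∩ π^{-1}(x). -/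
theorem mem_intrinsicInterior_iff_mem_nhdsWithin {E : Type*} [NormedAddCommGroup E]
    [NormedSpace ℝ E] {s : Set E} {p : E} :
    p ∈ intrinsicInterior ℝ s ↔
      p ∈ affineSpan ℝ s ∧ s ∈ nhdsWithin p (affineSpan ℝ s : Set E) := by
  rw [mem_intrinsicInterior]
  constructor
  · rintro ⟨y, hy, rfl⟩
    exact ⟨y.2, preimage_coe_mem_nhds_subtype.1 (mem_interior_iff_mem_nhds.1 hy)⟩
  · rintro ⟨hp, h⟩
    exact ⟨⟨p, hp⟩, mem_interior_iff_mem_nhds.2 (preimage_coe_mem_nhds_subtype.2 h), rfl⟩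

/-- A segment from a point of `s` to a point of the intrinsic interior can be prolonged in `s`. -/
theorem exists_mem_openSegment_of_mem_intrinsicInterior {E : Type*} [NormedAddCommGroup E]
    [NormedSpace ℝ E] {s : Set E} {p y : E} (hp : p ∈ intrinsicInterior ℝ s) (hy : y ∈ s) :
    ∃ r ∈ s, p ∈ openSegment ℝ y r := by
  obtain ⟨hpA, hnhds⟩ := mem_intrinsicInterior_iff_mem_nhdsWithin.1 hp
  have hline : Filter.Tendsto (fun t : ℝ => AffineMap.lineMap y p t) (nhdsWithin 1 (Set.Ioi 1))
      (nhdsWithin p (affineSpan ℝ s : Set E)) := by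
    refine tendsto_nhdsWithin_iff.2 ⟨?_, Filter.Eventually.of_forall fun t =>
      AffineMap.lineMap_mem t (subset_affineSpan ℝ s hy) hpA⟩
    have hc : Continuous fun t : ℝ => AffineMap.lineMap y p t := AffineMap.lineMap_continuous
    simpa using (hc.tendsto 1).mono_left nhdsWithin_le_nhds
  obtain ⟨t, ht, ht1⟩ := ((hline.eventually_mem hnhds).and self_mem_nhdsWithin).exists
  have ht1 : 1 < t := ht1
  have ht0 : t ≠ 0 := by positivity
  refine ⟨_, ht, 1 - t⁻¹, t⁻¹, sub_pos.2 (inv_lt_one_of_one_lt₀ ht1), by positivity,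
    by ring, ?_⟩
  simp only [AffineMap.lineMap_apply_module]
  match_scalars <;> field_simp
  ring

theorem Convex.mem_intrinsicInterior_of_mem_openSegment {E : Type*} [NormedAddCommGroup E]
    [NormedSpace ℝ E] {s : Set E} (hs : Convex ℝ s) {p z r : E}
    (hz : z ∈ intrinsicInterior ℝ s) (hr : r ∈ s) (hp : p ∈ openSegment ℝ z r) :
    p ∈ intrinsicInterior ℝ s := by
  obtain ⟨a, b, ha, hb, hab, rfl⟩ := hp
  obtain ⟨hzA, hnhds⟩ := mem_intrinsicInterior_iff_mem_nhdsWithin.1 hz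
  have hmem : a • z + b • r ∈ affineSpan ℝ s :=
    subset_affineSpan ℝ s (hs (intrinsicInterior_subset hz) hr ha.le hb.le hab)
  obtain rfl : b = 1 - a := by linarith
  refine mem_intrinsicInterior_iff_mem_nhdsWithin.2 ⟨hmem, ?_⟩
  have hhom : Filter.Tendsto (fun q : E => AffineMap.lineMap r q a⁻¹)
      (nhdsWithin (a • z + (1 - a) • r) (affineSpan ℝ s : Set E))
      (nhdsWithin z (affineSpan ℝ s : Set E)) := by
    refine tendsto_nhdsWithin_iff.2 ⟨?_, ?_⟩
    · have hc : Continuous fun q : E => AffineMap.lineMap r q a⁻¹ := by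
        simp only [AffineMap.lineMap_apply_module]
        fun_prop
      have hval : AffineMap.lineMap r (a • z + (1 - a) • r) a⁻¹ = z := by
        simp only [AffineMap.lineMap_apply_module]
        match_scalars <;> field_simp
        ring
      have h := (hc.tendsto (a • z + (1 - a) • r)).mono_left
        (nhdsWithin_le_nhds (s := (affineSpan ℝ s : Set E)))
      rwa [hval] at h
    · filter_upwards [self_mem_nhdsWithin] with q hq
      exact AffineMap.lineMap_mem _ (subset_affineSpan ℝ s hr) hq
  filter_upwards [hhom hnhds] with q hq
  convert hs hq hr ha.le hb.le hab using 1
  simp only [AffineMap.lineMap_apply_module]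
  match_scalars <;> field_simp
  ring

theorem Convex.mem_intrinsicInterior_iff_forall_openSegment {E : Type*} [NormedAddCommGroup E]
    [NormedSpace ℝ E] [FiniteDimensional ℝ E] {s : Set E} (hs : Convex ℝ s) {p : E} :
    p ∈ intrinsicInterior ℝ s ↔ p ∈ s ∧ ∀ y ∈ s, ∃ r ∈ s, p ∈ openSegment ℝ y r := by
  refine ⟨fun hp => ⟨intrinsicInterior_subset hp, fun y hy =>
    exists_mem_openSegment_of_mem_intrinsicInterior hp hy⟩, fun ⟨hp, h⟩ => ?_⟩
  obtain ⟨z, hz⟩ := Set.Nonempty.intrinsicInterior hs ⟨p, hp⟩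
  obtain ⟨r, hr, hpr⟩ := h z (intrinsicInterior_subset hz)
  exact hs.mem_intrinsicInterior_of_mem_openSegment hz hr hpr

/-- If a hyperplane meets a convex hull but avoids its generators, then every point strictly above
the hyperplane is separated by it from some generator. -/
theorem exists_mem_openSegment_of_mem_convexHull {E : Type*} [AddCommGroup E] [Module ℝ E]
    {V : Set E} (f : E →ₗ[ℝ] ℝ) {x : ℝ} (hx : ∀ v ∈ V, f v ≠ x) {p y : E}
    (hp : p ∈ convexHull ℝ V) (hpx : f p = x) (hyx : x < f y) :
    ∃ v ∈ V, ∃ z ∈ openSegment ℝ y v, f z = x := by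
  obtain ⟨v, hv, hvx⟩ : ∃ v ∈ V, f v < x := by
    by_contra! h
    have hsub : convexHull ℝ V ⊆ {w | x < f w} :=
      convexHull_min (fun v hv => lt_of_le_of_ne (h v hv) (hx v hv).symm)
        (convex_halfSpace_gt f.isLinear x)
    exact (hsub hp).ne' hpx
  have hd : 0 < f y - f v := by linarith
  refine ⟨v, hv, _, ⟨(x - f v) / (f y - f v), (f y - x) / (f y - f v),
    div_pos (by linarith) hd, div_pos (by linarith) hd, by field_simp; ring, rfl⟩, ?_⟩
  simp only [map_add, map_smul, smul_eq_mul]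
  field_simp
  ring

theorem Convex.exists_mem_openSegment_trans {E : Type*} [AddCommGroup E] [Module ℝ E]
    {s : Set E} (hs : Convex ℝ s) {p y z v q : E} (hv : v ∈ s) (hq : q ∈ s)
    (hz : z ∈ openSegment ℝ y v) (hp : p ∈ openSegment ℝ z q) :
    ∃ r ∈ s, p ∈ openSegment ℝ y r := by
  obtain ⟨a, b, ha, hb, hab, rfl⟩ := hz
  obtain ⟨c, d, hc, hd, hcd, rfl⟩ := hp
  have hpos : 0 < c * b + d := by positivity
  refine ⟨(c * b / (c * b + d)) • v + (d / (c * b + d)) • q,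
    hs hv hq (by positivity) (by positivity) (by field_simp), c * a, c * b + d,
    by positivity, hpos, by linear_combination c * hab + hcd, ?_⟩
  match_scalars <;> field_simp

theorem intrinsicInterior_convexHull_inter_hyperplane {E : Type*} [NormedAddCommGroup E]
    [NormedSpace ℝ E] [FiniteDimensional ℝ E] {V : Set E} (f : E →ₗ[ℝ] ℝ) {x : ℝ}
    (hx : ∀ v ∈ V, f v ≠ x) :
    intrinsicInterior ℝ (convexHull ℝ V ∩ {p | f p = x}) =
      intrinsicInterior ℝ (convexHull ℝ V) ∩ {p | f p = x} := by
  have hP : Convex ℝ (convexHull ℝ V) := convex_convexHull ℝ V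
  ext p
  rw [Set.mem_inter_iff, hP.mem_intrinsicInterior_iff_forall_openSegment,
    (hP.inter (convex_hyperplane f.isLinear x)).mem_intrinsicInterior_iff_forall_openSegment]
  constructor
  · rintro ⟨⟨hp, hpx : f p = x⟩, h⟩
    refine ⟨⟨hp, fun y hy => ?_⟩, hpx⟩
    rcases eq_or_ne (f y) x with hyx | hyx
    · obtain ⟨r, hr, hpr⟩ := h y ⟨hy, hyx⟩
      exact ⟨r, hr.1, hpr⟩
    obtain ⟨v, hv, z, hz, hzx⟩ : ∃ v ∈ V, ∃ z ∈ openSegment ℝ y v, f z = x := by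
      rcases hyx.lt_or_gt with hlt | hgt
      · simpa using exists_mem_openSegment_of_mem_convexHull (-f) (x := -x)
          (by simpa using hx) hp (by simpa using hpx) (by simpa using hlt)
      · exact exists_mem_openSegment_of_mem_convexHull f hx hp hpx hgt
    have hvP := subset_convexHull ℝ V hv
    obtain ⟨q, hq, hpq⟩ := h z ⟨hP.openSegment_subset hy hvP hz, hzx⟩
    exact hP.exists_mem_openSegment_trans hvP hq.1 hz hpq
  · rintro ⟨⟨hp, h⟩, hpx : f p = x⟩
    refine ⟨⟨hp, hpx⟩, fun y ⟨hy, (hyx : f y = x)⟩ => ?_⟩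
    obtain ⟨r, hr, a, b, ha, hb, hab, rfl⟩ := h y hy
    refine ⟨r, ⟨hr, ?_⟩, a, b, ha, hb, hab, rfl⟩
    simp only [map_add, map_smul, smul_eq_mul, hyx] at hpx
    exact mul_left_cancel₀ hb.ne' (by linear_combination hpx - x * hab)

/-- Let `P = conv V` for a finite `V ⊆ ℝ^m` and let `π` be the projection
onto the first coordinate. If `x` is not the first coordinate of any `v ∈ V`, then the
relative (intrinsic) interior of the cross-section `P ∩ π⁻¹(x)` equals
`(relint P) ∩ π⁻¹(x)`. -/
theorem relint_cross_section (m : ℕ) (hm : 0 < m)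
    (V : Set (Fin m → ℝ)) (hV : V.Finite)
    (x : ℝ) (hx : ∀ v ∈ V, v ⟨0, hm⟩ ≠ x) :
    intrinsicInterior ℝ (convexHull ℝ V ∩ {p : Fin m → ℝ | p ⟨0, hm⟩ = x}) =
      intrinsicInterior ℝ (convexHull ℝ V) ∩ {p : Fin m → ℝ | p ⟨0, hm⟩ = x} := by
  exact intrinsicInterior_convexHull_inter_hyperplane
    (LinearMap.proj (R := ℝ) (φ := fun _ : Fin m => ℝ) ⟨0, hm⟩) hx
end

section
/- Let m ≥ 2, n ≥ 1, and let B ∈ [0,1]^{m×n} be the column player's payoff matrix of a bimatrix game. For a row-player mixed strategy u ∈ Δ^{m-1} = {x ∈ ℝ^{m-1} : x_i ≥ 0, Σ x_i ≤ 1} (with implicit first coordinate u₀ = 1 − Σ_i u_i), let U^j_c(u) = Σ_{i=0}^{m-1} u'_i·B_{ij} denote the column player's expected utility for pure strategy j, where u' = (u₀, u₁, ..., u_{m-1}). Fix ε > 0 and set δ = ε/(2√(m−1)). Suppose u, u' ∈ Δ^{m-1} with ‖u − u'‖₂ ≤ δ, that j satisfies U^j_c(u) = max_k U^k_c(u), and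 that i satisfies U^i_c(u') = max_k U^k_c(u'). Then |U^i_c(u) − U^j_c(u)| ≤ ε; that is, pure strategy i is an ε-best response for the column player against u. -/
/-- The column player's expected utility for pure strategy `j` against the row-player
mixed strategy `u ∈ Δ^m` (over `m + 1` pure rows, the 0-th probability implicit):
`U^j_c(u) = (1 − ∑ i, u i) · B 0 j + ∑ i, u i · B (i+1) j`. -/
def colUtil (m n : ℕ) (B : Matrix (Fin (m + 1)) (Fin n) ℝ) (j : Fin n)
    (u : EuclideanSpace ℝ (Fin m)) : ℝ :=
  (1 - ∑ i, u i) * B 0 j + ∑ i : Fin m, u i * B i.succ j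

/-- The utility of a pure column strategy is `√m`-Lipschitz in the row player's mixed strategy
when the payoffs lie in `[0,1]`. -/
theorem abs_colUtil_sub_le (m n : ℕ) (B : Matrix (Fin (m + 1)) (Fin n) ℝ)
    (hB : ∀ i j, B i j ∈ Set.Icc (0 : ℝ) 1) (k : Fin n) (u v : EuclideanSpace ℝ (Fin m)) :
    |colUtil m n B k u - colUtil m n B k v| ≤ Real.sqrt m * dist u v := by
  have hsub : colUtil m n B k u - colUtil m n B k v =
      ∑ l, (B l.succ k - B 0 k) * (u l - v l) := by
    simp only [colUtil, sub_mul, mul_sub, Finset.sum_sub_distrib, mul_comm (B _ k)]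
    simp only [mul_comm _ (B 0 k), ← Finset.mul_sum]
    ring
  have hcoeff : ∑ l : Fin m, (B l.succ k - B 0 k) ^ 2 ≤ m := by
    calc ∑ l : Fin m, (B l.succ k - B 0 k) ^ 2 ≤ ∑ _l : Fin m, (1 : ℝ) := by
          refine Finset.sum_le_sum fun l _ => ?_
          obtain ⟨h₀, h₁⟩ := hB l.succ k
          obtain ⟨h₂, h₃⟩ := hB 0 k
          rw [sq_le_one_iff_abs_le_one, abs_le]
          constructor <;> linarith
      _ = m := by simp
  rw [hsub, EuclideanSpace.dist_eq, ← Real.sqrt_mul (Nat.cast_nonneg m)]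
  refine Real.abs_le_sqrt ((Finset.sum_mul_sq_le_sq_mul_sq _ _ _).trans ?_)
  simp only [Real.dist_eq, sq_abs]
  gcongr

/-- In a bimatrix game with `m + 1 ≥ 2` rows, column payoffs in `[0,1]`,
`δ = ε / (2√m)`: if `u, u'` are row mixed strategies with `‖u − u'‖₂ ≤ δ`, `j` is a best
response (for the column player) to `u` and `i` is a best response to `u'`, then
`|U^i_c(u) − U^j_c(u)| ≤ ε`, i.e. `i` is an `ε`-best response to `u`. -/
theorem close_best_responses (m n : ℕ) (hm : 1 ≤ m) (hn : 1 ≤ n)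
    (B : Matrix (Fin (m + 1)) (Fin n) ℝ) (hB : ∀ i j, B i j ∈ Set.Icc (0 : ℝ) 1)
    (ε : ℝ) (hε : 0 < ε)
    (u u' : EuclideanSpace ℝ (Fin m))
    (hu : u ∈ unitSimplex m) (hu' : u' ∈ unitSimplex m)
    (hd : dist u u' ≤ ε / (2 * Real.sqrt m))
    (j : Fin n) (hj : ∀ k, colUtil m n B k u ≤ colUtil m n B j u)
    (i : Fin n) (hi : ∀ k, colUtil m n B k u' ≤ colUtil m n B i u') :
    |colUtil m n B i u - colUtil m n B j u| ≤ ε := by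
  have hm' : 0 < Real.sqrt m := Real.sqrt_pos.2 (by exact_mod_cast hm)
  have hε' : Real.sqrt m * dist u u' ≤ ε / 2 :=
    calc Real.sqrt m * dist u u' ≤ Real.sqrt m * (ε / (2 * Real.sqrt m)) := by gcongr
      _ = ε / 2 := by field_simp
  have hi' := abs_le.1 ((abs_colUtil_sub_le m n B hB i u u').trans hε')
  have hj' := abs_le.1 ((abs_colUtil_sub_le m n B hB j u u').trans hε')
  rw [abs_le]
  constructor <;> linarith [hi j, hj i, hi'.1, hj'.2]
end

section
/- Let Ĉ_1, ..., Ĉ_n be nonempty compact convex subsets of Δ^{m-1} = {x ∈ ℝ^{m-1} : x_i ≥ 0, Σ x_i ≤ 1}. For each i define the Voronoi best response set V_i = {u ∈ Δ^{m-1} : dist(u, Ĉ_i) ≤ dist(u, Ĉ_j) for all j}, where dist is Euclidean distance to a set. Then each V_i is closed and path-connected. -/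
theorem isClosed_unitSimplex (m : ℕ) : IsClosed (unitSimplex m) := by
  simp only [unitSimplex, Set.ofPred_and, Set.ofPred_forall]
  exact (isClosed_iInter fun i => isClosed_le (by fun_prop) (by fun_prop)).inter
    (isClosed_le (by fun_prop) (by fun_prop))

/-- Moving from `u` straight towards a nearest point `p` of `A` keeps `A` at least as close
as any set `B` that was no closer to `u` than `A`. -/
theorem infDist_le_infDist_of_mem_segment {E : Type*} [NormedAddCommGroup E] [NormedSpace ℝ E]
    {A B : Set E} {u p w : E} (hp : p ∈ A) (hup : Metric.infDist u A = dist u p)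
    (hw : w ∈ segment ℝ u p) (h : Metric.infDist u A ≤ Metric.infDist u B) :
    Metric.infDist w A ≤ Metric.infDist w B := by
  have h₁ := dist_add_dist_of_mem_segment hw
  have h₂ := Metric.infDist_le_dist_of_mem (x := w) hp
  have h₃ := Metric.infDist_le_infDist_add_dist (s := B) (x := u) (y := w)
  linarith

/-- For nonempty compact convex subsets `Ĉ 1, ..., Ĉ n` of the simplex, each
Voronoi best response set `V i = {u ∈ Δ : ∀ j, dist(u, Ĉ i) ≤ dist(u, Ĉ j)}` is closed
and path-connected. -/
theorem voronoi_closed_pathConnected (m n : ℕ)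
    (C : Fin n → Set (EuclideanSpace ℝ (Fin m)))
    (hCne : ∀ i, (C i).Nonempty) (hCcompact : ∀ i, IsCompact (C i))
    (hCconv : ∀ i, Convex ℝ (C i)) (hCsub : ∀ i, C i ⊆ unitSimplex m)
    (i : Fin n) :
    IsClosed {u ∈ unitSimplex m |
        ∀ j, Metric.infDist u (C i) ≤ Metric.infDist u (C j)} ∧
    IsPathConnected {u ∈ unitSimplex m |
        ∀ j, Metric.infDist u (C i) ≤ Metric.infDist u (C j)} := by
  have hmem : C i ⊆ {u ∈ unitSimplex m |
      ∀ j, Metric.infDist u (C i) ≤ Metric.infDist u (C j)} := fun x hx =>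
    ⟨hCsub i hx, fun j => (Metric.infDist_zero_of_mem hx).trans_le Metric.infDist_nonneg⟩
  constructor
  · simp only [Set.ofPred_and, Set.ofPred_forall]
    exact (isClosed_unitSimplex m).inter <| isClosed_iInter fun j =>
      isClosed_le (Metric.continuous_infDist_pt _) (Metric.continuous_infDist_pt _)
  · obtain ⟨q, hq⟩ := hCne i
    refine ⟨q, hmem hq, fun {u} hu => ?_⟩
    obtain ⟨p, hp, hup⟩ := (hCcompact i).exists_infDist_eq_dist (hCne i) u
    have hqp := JoinedIn.of_segment_subset (((hCconv i).segment_subset hq hp).trans hmem)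
    have hup' : JoinedIn {u ∈ unitSimplex m |
        ∀ j, Metric.infDist u (C i) ≤ Metric.infDist u (C j)} u p :=
      JoinedIn.of_segment_subset fun w hw =>
        ⟨(convex_unitSimplex m).segment_subset hu.1 (hCsub i hp) hw,
          fun j => infDist_le_infDist_of_mem_segment hp hup hw (hu.2 j)⟩
    exact hqp.trans hup'.symm
end

section
/- Let m, n ≥ 1. For each j ∈ {1,...,n} let Ĉ_j be a nonempty closed subset of the standard simplex Δ(m) = {u ∈ ℝ^m : u_i ≥ 0, Σ u_i = 1}, and for each i ∈ {1,...,m} let R̂_i be a nonempty closed subset of Δ(n) = {v ∈ ℝ^n : v_j ≥ 0, Σ v_j = 1}. Then there exists a pair (u*, v*) ∈ Δ(m) × Δ(n) such that: for every i with u*_i > 0, dist(v*, R̂_i) ≤ dist(v*, R̂_{i'}) for all i'; and for every j with v*_j > 0, dist(u*, Ĉ_j) ≤ dist(u*, Ĉ_{j'}) for all j'. In other words, the Voronoi approximate best response correspondence B*(u,v) = (conv{e_i : i minimizes dist(v, R̂_i)}, conv{e_j : j minimizes dist(u, Ĉ_j)}) has a fixed point. -/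
/-- The standard probability simplex `Δ(m) = {u ∈ ℝ^m : ∀ i, u i ≥ 0, ∑ i, u i = 1}`
viewed inside Euclidean space. -/
def probSimplex (m : ℕ) : Set (EuclideanSpace ℝ (Fin m)) :=
  {u | (∀ i, 0 ≤ u i) ∧ ∑ i, u i = 1}

open Finset Filter Topology

/-- A finite set `σ` is dominant for the rankings `r i` when every element `y` is ranked, by some
`r i`, at most as high as all elements of `σ`. -/
def IsDominant {X I : Type*} (r : I → X → ℕ) (σ : Finset X) : Prop :=
  ∀ y, ∃ i, ∀ x ∈ σ, r i y ≤ r i x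

section Pivot

variable {X I : Type*} [Fintype X] [DecidableEq X] {r : I → X → ℕ}

theorem IsDominant.exists_insert (hr : ∀ i, Function.Injective (r i)) {τ : Finset X}
    (hτ : IsDominant r τ) {f : I → X} (hfτ : ∀ i, f i ∈ τ)
    (hf : ∀ i, ∀ x ∈ τ, r i (f i) ≤ r i x) {a a' : I} (haa : a' ≠ a) (hfa : f a' = f a)
    (hinj : ∀ b b', b ≠ a → b' ≠ a → f b = f b' → b = b')
    (hne : ∃ y, ∀ b, b ≠ a → r b (f b) < r b y) :
    ∃ x, (∀ b, b ≠ a → r b (f b) < r b x) ∧ x ∉ τ ∧ IsDominant r (insert x τ) ∧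
      ∀ x', IsDominant r (insert x' τ) → r a x' < r a (f a) → x' = x := by
  classical
  have hsurj : ∀ x ∈ τ, ∃ i, f i = x := fun x hx => by
    obtain ⟨i, hi⟩ := hτ x
    exact ⟨i, hr i (le_antisymm (hf i x hx) (hi _ (hfτ i)))⟩
  obtain ⟨y, hy⟩ := hne
  obtain ⟨x, hxM, hmax⟩ := Finset.exists_max_image
    (univ.filter fun y => ∀ b, b ≠ a → r b (f b) < r b y) (r a) ⟨y, by simpa using hy⟩
  simp only [mem_filter, mem_univ, true_and] at hxM hmax
  refine ⟨x, hxM, fun hx => ?_, fun z => ?_, fun x' hx' hlt => ?_⟩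
  · obtain ⟨b, hb⟩ := hsurj x hx
    by_cases hba : b = a
    · have := hxM a' haa
      rw [hfa, ← hba, hb] at this
      exact lt_irrefl _ this
    · have := hxM b hba
      rw [hb] at this
      exact lt_irrefl _ this
  · by_cases hz : ∀ b, b ≠ a → r b (f b) < r b z
    · refine ⟨a, fun w hw => ?_⟩
      rcases mem_insert.1 hw with rfl | hw
      · exact hmax z hz
      · obtain ⟨b, hb⟩ := hτ x
        have hba : b = a := by
          by_contra hba
          exact absurd (hb _ (hfτ b)) (not_le.2 (hxM b hba))
        subst hba
        exact (hmax z hz).trans (hb w hw)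
    · push Not at hz
      obtain ⟨b, hba, hb⟩ := hz
      refine ⟨b, fun w hw => ?_⟩
      rcases mem_insert.1 hw with rfl | hw
      · exact hb.trans (hxM b hba).le
      · exact hb.trans (hf b w hw)
  · have hx'M : ∀ b, b ≠ a → r b (f b) < r b x' := by
      intro b hb
      obtain ⟨b', hb'⟩ := hx' (f b)
      have h1 : f b' = f b := hr b' (le_antisymm (hf b' _ (hfτ b))
        (hb' _ (mem_insert_of_mem (hfτ b'))))
      have h2 : r b' (f b') ≤ r b' x' := h1 ▸ hb' x' (mem_insert_self _ _)
      have hb'a : b' ≠ a := by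
        rintro rfl
        exact absurd h2 (not_le.2 hlt)
      obtain rfl := hinj b' b hb'a hb h1
      refine lt_of_le_of_ne h2 fun h => ?_
      have h3 := hr _ h
      have h4 : x' ∈ τ := h3 ▸ hfτ b'
      exact absurd (hf a _ h4) (not_le.2 hlt)
    obtain ⟨b, hb⟩ := hx' x
    have hba : b = a := by
      by_contra hba
      exact absurd (hb _ (mem_insert_of_mem (hfτ b))) (not_le.2 (hxM b hba))
    subst hba
    exact hr b (le_antisymm (hmax x' hx'M) (hb x' (mem_insert_self _ _)))

theorem IsDominant.exists_pair [Fintype I] (hr : ∀ i, Function.Injective (r i)) {τ : Finset X}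
    (hτ : IsDominant r τ) (hcard : #τ + 1 = Fintype.card I) (hτne : τ.Nonempty)
    (hne : ∀ a, ∃ y, ∀ b, b ≠ a → ∃ x ∈ τ, r b x < r b y) :
    ∃ x x', x ≠ x' ∧ x ∉ τ ∧ x' ∉ τ ∧
      ∀ z, z ∉ τ → (IsDominant r (insert z τ) ↔ z = x ∨ z = x') := by
  classical
  choose f hfτ hf using fun i => Finset.exists_min_image τ (r i) hτne
  have hsurj : ∀ x ∈ τ, ∃ i, f i = x := fun x hx => by
    obtain ⟨i, hi⟩ := hτ x
    exact ⟨i, hr i (le_antisymm (hf i x hx) (hi _ (hfτ i)))⟩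
  have hne' : ∀ a, ∃ y, ∀ b, b ≠ a → r b (f b) < r b y := fun a => by
    obtain ⟨y, hy⟩ := hne a
    refine ⟨y, fun b hb => ?_⟩
    obtain ⟨x, hx, hlt⟩ := hy b hb
    exact (hf b x hx).trans_lt hlt
  obtain ⟨i, -, j, -, hij, hfij⟩ := Finset.exists_ne_map_eq_of_card_lt_of_maps_to
    (s := univ) (t := τ) (by rw [Finset.card_univ]; omega) (fun i _ => hfτ i)
  have hinj : ∀ i j, i ≠ j → f i = f j → ∀ b b', b ≠ i → b' ≠ i → f b = f b' → b = b' := by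
    intro i j hij hfij b b' hb hb' h
    have himg : (univ.erase i).image f = τ := by
      ext x
      simp only [mem_image, mem_erase, mem_univ, and_true]
      constructor
      · rintro ⟨b, -, rfl⟩
        exact hfτ b
      · intro hx
        obtain ⟨b, rfl⟩ := hsurj x hx
        by_cases hbi : b = i
        · exact ⟨j, hij.symm, by rw [hbi, hfij]⟩
        · exact ⟨b, hbi, rfl⟩
    have hc : #((univ.erase i).image f) = #(univ.erase i) := by
      rw [himg, card_erase_of_mem (mem_univ _), Finset.card_univ]
      omega
    exact Finset.card_image_iff.1 hc (by simpa using hb) (by simpa using hb') h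
  obtain ⟨x, hxM, hxτ, hxd, hxu⟩ :=
    hτ.exists_insert hr hfτ hf hij.symm hfij.symm (hinj i j hij hfij) (hne' i)
  obtain ⟨x', hxM', hxτ', hxd', hxu'⟩ :=
    hτ.exists_insert hr hfτ hf hij hfij (hinj j i hij.symm hfij.symm) (hne' j)
  refine ⟨x, x', ?_, hxτ, hxτ', fun z hz => ⟨fun hzd => ?_, ?_⟩⟩
  · rintro rfl
    obtain ⟨b, hb⟩ := hτ x
    by_cases hbi : b = i
    · exact absurd (hb _ (hfτ b)) (not_le.2 (hxM' b (hbi ▸ hij)))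
    · exact absurd (hb _ (hfτ b)) (not_le.2 (hxM b hbi))
  · obtain ⟨a, ha⟩ := hzd z
    have hlt : ∀ b, r b z ≤ r b (f b) → r b z < r b (f b) := fun b hb =>
      lt_of_le_of_ne hb fun h => hz (hr b h ▸ hfτ b)
    have hza := hlt a (ha _ (mem_insert_of_mem (hfτ a)))
    by_cases hai : a = i
    · subst hai
      exact Or.inl (hxu z hzd hza)
    by_cases haj : a = j
    · subst haj
      exact Or.inr (hxu' z hzd hza)
    exfalso
    obtain ⟨b, hb⟩ := hzd (f a)
    have h1 : f b = f a := hr b (le_antisymm (hf b _ (hfτ a))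
      (hb _ (mem_insert_of_mem (hfτ b))))
    have h2 : r b (f b) ≤ r b z := h1 ▸ hb z (mem_insert_self _ _)
    have hba : b ≠ a := by
      rintro rfl
      exact absurd h2 (not_le.2 hza)
    by_cases hbi : b = i
    · exact hba (hinj j i hij.symm hfij.symm b a (hbi ▸ hij) haj h1)
    · exact hba (hinj i j hij hfij b a hbi hai h1)
  · rintro (rfl | rfl)
    · exact hxd
    · exact hxd'

end Pivot

theorem even_card_filter_image_eq_erase {X I : Type*} [DecidableEq X] [Fintype I] [DecidableEq I]
    (c : X → I) (i₀ : I) {σ : Finset X} (hσ : #σ = Fintype.card I) (hc : σ.image c ≠ univ) :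
    Even #(σ.powerset.filter fun τ => τ.image c = univ.erase i₀ ∧ #τ + 1 = Fintype.card I) := by
  rcases Finset.eq_empty_or_nonempty
    (σ.powerset.filter fun τ => τ.image c = univ.erase i₀ ∧ #τ + 1 = Fintype.card I) with h | h
  · simp [h]
  obtain ⟨τ, hτ⟩ := h
  simp only [mem_filter, mem_powerset] at hτ
  obtain ⟨hτσ, himg, hcard⟩ := hτ
  obtain ⟨x, hxτ, rfl⟩ := Finset.exists_eq_insert_iff.2 ⟨hτσ, by omega⟩
  have hinj : Set.InjOn c τ := Finset.card_image_iff.1 (by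
    rw [himg, card_erase_of_mem (mem_univ _), Finset.card_univ]; omega)
  have hxi : c x ≠ i₀ := by
    intro h
    apply hc
    rw [image_insert, himg, h, insert_erase (mem_univ _)]
  obtain ⟨x', hx'τ, hx'⟩ : ∃ x' ∈ τ, c x' = c x := by
    rw [← mem_image, himg]
    simpa using hxi
  have hxx' : x ≠ x' := fun h => hxτ (h ▸ hx'τ)
  have hx'mem : x' ∈ insert x τ := mem_insert_of_mem hx'τ
  suffices h : ((insert x τ).powerset.filter fun τ =>
      τ.image c = univ.erase i₀ ∧ #τ + 1 = Fintype.card I) = {τ, (insert x τ).erase x'} by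
    rw [h, card_pair]
    · exact even_two
    · intro h
      have : x' ∈ (insert x τ).erase x' := h ▸ hx'τ
      simp at this
  ext ρ
  simp only [mem_filter, mem_powerset, mem_insert, mem_singleton]
  constructor
  · rintro ⟨hρ, himgρ, hcardρ⟩
    obtain ⟨y, hyρ, hy⟩ := Finset.exists_eq_insert_iff.2 ⟨hρ, by omega⟩
    have hyσ : y ∈ insert x τ := hy ▸ mem_insert_self _ _
    have hρe : ρ = (insert x τ).erase y := by rw [← hy, erase_insert hyρ]
    by_cases hyx : y = x
    · left
      rw [hρe, hyx, erase_insert hxτ]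
    by_cases hyx' : y = x'
    · right
      rw [hρe, hyx']
    exfalso
    have hyτ : y ∈ τ := (mem_insert.1 hyσ).resolve_left hyx
    have hcy : c y ∈ ρ.image c := by
      rw [himgρ, ← himg]
      exact mem_image_of_mem _ hyτ
    obtain ⟨z, hz, hzy⟩ := mem_image.1 hcy
    rw [hρe, mem_erase] at hz
    rcases mem_insert.1 hz.2 with rfl | hzτ
    · exact hyx' (hinj hyτ hx'τ (by rw [← hzy, hx']))
    · exact hz.1 (hinj hzτ hyτ hzy)
  · rintro (rfl | rfl)
    · exact ⟨subset_insert _ _, himg, hcard⟩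
    · refine ⟨erase_subset _ _, ?_, by rw [card_erase_of_mem hx'mem]; omega⟩
      rw [← himg]
      ext i
      simp only [mem_image, mem_erase, mem_insert]
      constructor
      · rintro ⟨z, ⟨hz, rfl | hzτ⟩, rfl⟩
        · exact ⟨x', hx'τ, hx'⟩
        · exact ⟨z, hzτ, rfl⟩
      · rintro ⟨z, hzτ, rfl⟩
        by_cases hzx : z = x'
        · exact ⟨x, ⟨hxx', Or.inl rfl⟩, by rw [hzx, hx']⟩
        · exact ⟨z, ⟨hzx, Or.inr hzτ⟩, rfl⟩

/-- A parity count of the pairs (dominant set, almost colourful facet) gives a colourful dominant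
set, provided every almost colourful facet but one can be exchanged in two ways. -/
theorem exists_isDominant_image_eq_univ {X I : Type*} [Fintype X] [DecidableEq X] [Fintype I]
    [DecidableEq I] {r : I → X → ℕ} (hr : ∀ i, Function.Injective (r i)) (c : X → I) (i₀ : I)
    (τ₀ : Finset X) (hτ₀ : τ₀.image c = univ.erase i₀) (hτ₀card : #τ₀ + 1 = Fintype.card I)
    (h₀ : ∃! x, x ∉ τ₀ ∧ IsDominant r (insert x τ₀))
    (hne : ∀ τ : Finset X, τ ≠ τ₀ → τ.image c = univ.erase i₀ → #τ + 1 = Fintype.card I →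
      τ.Nonempty ∧ ∀ a, ∃ y, ∀ b, b ≠ a → ∃ x ∈ τ, r b x < r b y) :
    ∃ σ : Finset X, IsDominant r σ ∧ σ.image c = univ := by
  classical
  by_contra! hcon
  set rooms : Finset (Finset X) := univ.filter fun σ => IsDominant r σ ∧ #σ = Fintype.card I
    with hrooms
  set doors : Finset (Finset X) := univ.filter fun τ =>
    τ.image c = univ.erase i₀ ∧ #τ + 1 = Fintype.card I with hdoors
  have hcount := Finset.sum_card_bipartiteAbove_eq_sum_card_bipartiteBelow
    (s := rooms) (t := doors) (fun σ τ => τ ⊆ σ)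
  have heven : Even (∑ σ ∈ rooms, #(doors.bipartiteAbove (fun σ τ => τ ⊆ σ) σ)) := by
    refine Finset.even_sum _ fun σ hσ => ?_
    simp only [hrooms, mem_filter, mem_univ, true_and] at hσ
    have h := even_card_filter_image_eq_erase c i₀ hσ.2 (hcon σ hσ.1)
    suffices heq : doors.bipartiteAbove (fun σ τ => τ ⊆ σ) σ = σ.powerset.filter fun τ =>
        τ.image c = univ.erase i₀ ∧ #τ + 1 = Fintype.card I by rwa [heq]
    ext τ
    simp only [bipartiteAbove, hdoors, mem_filter, mem_univ, true_and, mem_powerset]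
    tauto
  have habove : ∀ τ ∈ doors, ∀ σ, σ ∈ rooms.bipartiteBelow (fun σ τ => τ ⊆ σ) τ ↔
      ∃ x, x ∉ τ ∧ insert x τ = σ ∧ IsDominant r σ := by
    intro τ hτ σ
    simp only [hdoors, mem_filter, mem_univ, true_and] at hτ
    simp only [bipartiteBelow, hrooms, mem_filter, mem_univ, true_and]
    constructor
    · rintro ⟨⟨hd, hc⟩, hsub⟩
      obtain ⟨x, hx, hxσ⟩ := Finset.exists_eq_insert_iff.2 ⟨hsub, by omega⟩
      exact ⟨x, hx, hxσ, hd⟩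
    · rintro ⟨x, hx, rfl, hd⟩
      exact ⟨⟨hd, by rw [card_insert_of_notMem hx]; exact hτ.2⟩, subset_insert _ _⟩
  have hτ₀mem : τ₀ ∈ doors := by simp [hdoors, hτ₀, hτ₀card]
  rw [hcount, ← Finset.add_sum_erase _ _ hτ₀mem] at heven
  have hone : #(rooms.bipartiteBelow (fun σ τ => τ ⊆ σ) τ₀) = 1 := by
    obtain ⟨x, ⟨hx, hd⟩, hu⟩ := h₀
    rw [card_eq_one]
    refine ⟨insert x τ₀, ?_⟩
    ext σ
    rw [habove τ₀ hτ₀mem, mem_singleton]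
    constructor
    · rintro ⟨y, hy, rfl, hyd⟩
      rw [hu y ⟨hy, hyd⟩]
    · rintro rfl
      exact ⟨x, hx, rfl, hd⟩
  have hrest : Even (∑ τ ∈ doors.erase τ₀, #(rooms.bipartiteBelow (fun σ τ => τ ⊆ σ) τ)) := by
    refine Finset.even_sum _ fun τ hτ => ?_
    obtain ⟨hττ₀, hτd⟩ := mem_erase.1 hτ
    have hτ' := hτd
    simp only [hdoors, mem_filter, mem_univ, true_and] at hτ'
    obtain ⟨hτne, hτy⟩ := hne τ hττ₀ hτ'.1 hτ'.2
    by_cases hτdom : IsDominant r τ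
    · obtain ⟨x, x', hxx', hx, hx', hiff⟩ := hτdom.exists_pair hr hτ'.2 hτne hτy
      suffices h : rooms.bipartiteBelow (fun σ τ => τ ⊆ σ) τ = {insert x τ, insert x' τ} by
        rw [h, card_pair]
        · exact even_two
        · intro h
          have : x ∈ insert x' τ := h ▸ mem_insert_self _ _
          exact (mem_insert.1 this).elim hxx' hx
      ext σ
      rw [habove τ hτd, mem_insert, mem_singleton]
      constructor
      · rintro ⟨z, hz, rfl, hzd⟩
        rcases (hiff z hz).1 hzd with rfl | rfl
        · exact Or.inl rfl
        · exact Or.inr rfl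
      · rintro (rfl | rfl)
        · exact ⟨x, hx, rfl, (hiff x hx).2 (Or.inl rfl)⟩
        · exact ⟨x', hx', rfl, (hiff x' hx').2 (Or.inr rfl)⟩
    · suffices h : rooms.bipartiteBelow (fun σ τ => τ ⊆ σ) τ = ∅ by simp [h]
      rw [Finset.eq_empty_iff_forall_notMem]
      intro σ hσ
      obtain ⟨x, -, rfl, hd⟩ := (habove τ hτd σ).1 hσ
      refine hτdom fun y => ?_
      obtain ⟨i, hi⟩ := hd y
      exact ⟨i, fun x hx => hi x (mem_insert_of_mem hx)⟩
  rw [hone] at heven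
  have := hrest.one_add
  exact (Nat.not_even_iff_odd.2 this) heven

/-- **Scarf's lemma** for injective rankings `r i` of a nonempty finite set. -/
theorem exists_scarf_pair {T I : Type*} [Fintype T] [Nonempty T] [Fintype I] [Nonempty I]
    (r : I → T → ℕ) (hr : ∀ i, Function.Injective (r i)) (c : T → I) :
    ∃ (σ : Finset T) (C : Finset I), (∀ y, ∃ i ∈ C, ∀ x ∈ σ, r i y ≤ r i x) ∧
      ∀ i ∈ C, ∃ x ∈ σ, c x = i := by
  classical
  obtain ⟨i₀⟩ := ‹Nonempty I›
  obtain ⟨B, hB⟩ : ∃ B, ∀ i t, r i t + 1 < B := by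
    refine ⟨∑ i, ∑ t, r i t + 2, fun i t => ?_⟩
    have h1 : r i t ≤ ∑ t, r i t := single_le_sum (f := fun t => r i t) (by simp) (mem_univ t)
    have h2 : ∑ t, r i t ≤ ∑ i, ∑ t, r i t :=
      single_le_sum (f := fun i => ∑ t, r i t) (by simp) (mem_univ i)
    omega
  let e := Fintype.equivFin I
  -- The slack element `inr i` is ranked lowest by `s i` and above all of `T` by the others.
  let s : I → T ⊕ I → ℕ := fun i =>
    Sum.elim (fun t => r i t + 1) (fun j => if j = i then 0 else B + e j)
  have hsl : ∀ i t, s i (Sum.inl t) = r i t + 1 := fun _ _ => rfl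
  have hss : ∀ i, s i (Sum.inr i) = 0 := fun i => if_pos rfl
  have hsr : ∀ i j, j ≠ i → s i (Sum.inr j) = B + e j := fun i j h => if_neg h
  have hs : ∀ i, Function.Injective (s i) := by
    rintro i (t | j) (t' | j') h
    · rw [hsl, hsl] at h
      rw [hr i (by omega : r i t = r i t')]
    · exfalso
      have := hB i t
      by_cases hj : j' = i
      · subst hj; rw [hsl, hss] at h; omega
      · rw [hsl, hsr i _ hj] at h; omega
    · exfalso
      have := hB i t'
      by_cases hj : j = i
      · subst hj; rw [hsl, hss] at h; omega
      · rw [hsl, hsr i _ hj] at h; omega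
    · have := hB i (Classical.arbitrary T)
      by_cases hj : j = i <;> by_cases hj' : j' = i
      · rw [hj, hj']
      · subst hj; rw [hss, hsr _ _ hj'] at h; omega
      · subst hj'; rw [hss, hsr _ _ hj] at h; omega
      · rw [hsr _ _ hj, hsr _ _ hj'] at h
        rw [e.injective (Fin.ext (by omega : (e j : ℕ) = e j'))]
  let d : T ⊕ I → I := Sum.elim c id
  have hmem₀ : ∀ z : T ⊕ I, z ∈ (univ.erase i₀).image (Sum.inr : I → T ⊕ I) ↔
      ∃ j, j ≠ i₀ ∧ Sum.inr j = z := by simp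
  obtain ⟨ρ, hρ, hρc⟩ : ∃ σ : Finset (T ⊕ I), IsDominant s σ ∧ σ.image d = univ := by
    refine exists_isDominant_image_eq_univ hs d i₀ ((univ.erase i₀).image Sum.inr) ?_ ?_ ?_ ?_
    · rw [image_image]
      exact image_id
    · rw [card_image_of_injective _ Sum.inr_injective, card_erase_of_mem (mem_univ _),
        Finset.card_univ]
      have := Fintype.card_pos_iff.2 ⟨i₀⟩
      omega
    · obtain ⟨t, -, ht⟩ := Finset.exists_max_image univ (r i₀) univ_nonempty
      refine ⟨Sum.inl t, ⟨by simp, ?_⟩, ?_⟩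
      · rintro (y | j)
        · refine ⟨i₀, fun x hx => ?_⟩
          rcases mem_insert.1 hx with rfl | hx
          · rw [hsl, hsl]
            exact Nat.succ_le_succ (ht y (mem_univ _))
          · obtain ⟨j, hj, rfl⟩ := (hmem₀ x).1 hx
            rw [hsl, hsr _ _ hj]
            have := hB i₀ y
            omega
        · exact ⟨j, fun x _ => by rw [hss]; exact Nat.zero_le _⟩
      · rintro (t' | j) ⟨hz, hzd⟩
        · obtain ⟨i, hi⟩ := hzd (Sum.inl t)
          by_cases hii : i = i₀
          · subst hii
            have h := hi _ (mem_insert_self _ _)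
            rw [hsl, hsl] at h
            have h' := ht t' (mem_univ _)
            rw [hr i (by omega : r i t' = r i t)]
          · have h := hi (Sum.inr i) (mem_insert_of_mem ((hmem₀ _).2 ⟨i, hii, rfl⟩))
            rw [hsl, hss] at h
            omega
        · exfalso
          obtain ⟨i, hi⟩ := hzd (Sum.inl t)
          have h : s i (Sum.inl t) ≤ s i (Sum.inr i) := by
            refine hi _ (mem_insert.2 ?_)
            by_cases hii : i = i₀
            · left
              by_contra hne
              exact hz ((hmem₀ _).2 ⟨j, fun h => hne (by rw [hii, h]), rfl⟩)
            · exact Or.inr ((hmem₀ _).2 ⟨i, hii, rfl⟩)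
          rw [hsl, hss] at h
          omega
    · intro τ hτ hτc hτcard
      obtain ⟨t, ht⟩ : ∃ t, Sum.inl t ∈ τ := by
        by_contra! hno
        refine hτ ?_
        ext z
        rw [hmem₀]
        constructor
        · intro hz
          rcases z with t | j
          · exact absurd hz (hno t)
          · have : d (Sum.inr j) ∈ τ.image d := mem_image_of_mem _ hz
            rw [hτc, mem_erase] at this
            exact ⟨j, this.1, rfl⟩
        · rintro ⟨j, hj, rfl⟩
          have : j ∈ τ.image d := by rw [hτc]; simpa using hj
          obtain ⟨z, hz, rfl⟩ := mem_image.1 this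
          rcases z with t | j
          · exact absurd hz (hno t)
          · exact hz
      refine ⟨⟨_, ht⟩, fun a => ⟨Sum.inr a, fun b hb => ⟨_, ht, ?_⟩⟩⟩
      rw [hsl, hsr _ _ hb.symm]
      have := hB b t
      omega
  refine ⟨univ.filter fun t => Sum.inl t ∈ ρ, univ.filter fun i => Sum.inr i ∉ ρ, fun y => ?_,
    fun i hi => ?_⟩
  · obtain ⟨i, hi⟩ := hρ (Sum.inl y)
    refine ⟨i, ?_, fun x hx => ?_⟩
    · simp only [mem_filter, mem_univ, true_and]
      intro h
      have := hi _ h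
      rw [hsl, hss] at this
      omega
    · have := hi _ (mem_filter.1 hx).2
      rw [hsl, hsl] at this
      omega
  · have : i ∈ ρ.image d := hρc ▸ mem_univ i
    obtain ⟨z, hz, rfl⟩ := mem_image.1 this
    rcases z with t | j
    · exact ⟨t, by simpa using hz, rfl⟩
    · exact absurd hz (mem_filter.1 hi).2

/-- Scarf's lemma on the grid of nonnegative integer vectors with sum `N`. -/
theorem exists_close_grid_points {ι : Type*} [Fintype ι] [Nonempty ι] (N : ℕ)
    (c : (ι → ℕ) → ι) :
    ∃ p : ι → ℕ, ∑ i, p i = N ∧ ∀ i, p i ≤ Fintype.card ι ∨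
      ∃ q : ι → ℕ, ∑ j, q j = N ∧ c q = i ∧
        ∀ j, q j ≤ p j + Fintype.card ι ∧ p j ≤ q j + Fintype.card ι := by
  classical
  let T := {x : ι → ℕ // x ∈ (univ : Finset ι).piAntidiag N}
  have hT : ∀ x : ι → ℕ, ∑ i, x i = N → x ∈ (univ : Finset ι).piAntidiag N := fun x hx => by simpa using hx
  have hT' : ∀ x : T, ∑ i, x.1 i = N := fun x => (mem_piAntidiag.1 x.2).1
  have : Fintype T := inferInstanceAs (Fintype ((univ : Finset ι).piAntidiag N))
  obtain ⟨i₀⟩ := ‹Nonempty ι›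
  have : Nonempty T := ⟨⟨Pi.single i₀ N, hT _ (by simp)⟩⟩
  let e := Fintype.equivFin T
  let r : ι → T → ℕ := fun i x => x.1 i * Fintype.card T + e x
  have hrle : ∀ i x y, r i x ≤ r i y → x.1 i ≤ y.1 i := by
    intro i x y h
    by_contra! hlt
    have h1 := Nat.mul_le_mul_right (Fintype.card T) (Nat.succ_le_of_lt hlt)
    have h2 := (e y).2
    simp only [r] at h
    rw [Nat.succ_mul] at h1
    omega
  have hr : ∀ i, Function.Injective (r i) := by
    intro i x y h
    have h1 : x.1 i = y.1 i := le_antisymm (hrle i x y h.le) (hrle i y x h.ge)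
    simp only [r, h1] at h
    exact e.injective (Fin.ext (by omega))
  obtain ⟨σ, C, hdom, hcol⟩ := exists_scarf_pair r hr (fun x => c x.1)
  obtain ⟨i₁, hi₁, -⟩ := hdom (Classical.arbitrary T)
  obtain ⟨p, hp, -⟩ := hcol i₁ hi₁
  choose f hfσ hf using fun i => Finset.exists_min_image σ (fun x => x.1 i) ⟨p, hp⟩
  have hsum : N < ∑ i ∈ C, ((f i).1 i + 1) := by
    by_contra! hle
    let y : ι → ℕ := fun i => (if i ∈ C then (f i).1 i + 1 else 0) +
      (if i = i₀ then N - ∑ i ∈ C, ((f i).1 i + 1) else 0)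
    have hy : ∑ i, y i = N := by
      simp only [y, sum_add_distrib, sum_ite_mem, univ_inter, sum_ite_eq', mem_univ, if_true]
      rw [← sum_add_distrib]
      omega
    obtain ⟨i, hiC, hi⟩ := hdom ⟨y, hT y hy⟩
    have h := hrle _ _ _ (hi _ (hfσ i))
    simp only [y, if_pos hiC] at h
    omega
  have hlow : ∀ x ∈ σ, ∀ j, (if j ∈ C then (f j).1 j else 0) ≤ x.1 j := by
    intro x hx j
    split_ifs
    · exact hf j x hx
    · exact Nat.zero_le _
  have hclose : ∀ x ∈ σ, ∀ i, x.1 i ≤ (if i ∈ C then (f i).1 i else 0) + Fintype.card ι := by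
    intro x hx i
    have h2 : ∑ j ∈ C, ((f j).1 j + 1) ≤
        ∑ j, (if j ∈ C then (f j).1 j else 0) + Fintype.card ι := by
      rw [sum_add_distrib, sum_ite_mem, univ_inter]
      simpa using card_le_univ C
    have h3 := hT' x
    rw [← add_sum_erase _ _ (mem_univ i)] at h2 h3
    have h4 : ∑ j ∈ univ.erase i, (if j ∈ C then (f j).1 j else 0) ≤
      ∑ j ∈ univ.erase i, x.1 j := sum_le_sum fun j _ => hlow x hx j
    have h1 := hlow x hx i
    omega
  refine ⟨p.1, hT' p, fun i => ?_⟩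
  by_cases hi : i ∈ C
  · obtain ⟨q, hq, hqi⟩ := hcol i hi
    refine Or.inr ⟨q.1, hT' q, hqi, fun j => ?_⟩
    have h1 := hclose p hp j
    have h2 := hclose q hq j
    have h3 := hlow p hp j
    have h4 := hlow q hq j
    omega
  · left
    have h1 := hclose p hp i
    rw [if_neg hi] at h1
    omega

/-- A continuous family `H` on the simplex has a point whose support consists of indices
minimising `H`. -/
theorem exists_mem_stdSimplex_support_minimizes {ι : Type*} [Fintype ι] [Nonempty ι]
    (H : ι → (ι → ℝ) → ℝ) (hH : ∀ i, Continuous (H i)) :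
    ∃ z ∈ stdSimplex ℝ ι, ∀ i, 0 < z i → ∀ j, H i z ≤ H j z := by
  classical
  choose c hc using fun x : ι → ℝ => Finite.exists_min (fun i => H i x)
  obtain ⟨K, hK0⟩ : ∃ K : ℝ, K = Fintype.card ι := ⟨_, rfl⟩
  have key : ∀ N : ℕ, ∃ p ∈ stdSimplex ℝ ι, ∀ i, p i ≤ K / ((N : ℝ) + 1) ∨
      ∃ q : ι → ℝ, (∀ j, H i q ≤ H j q) ∧ ∀ j, |q j - p j| ≤ K / ((N : ℝ) + 1) := by
    intro N
    have hN : (0 : ℝ) < (N : ℝ) + 1 := by positivity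
    obtain ⟨p, hp, h⟩ := exists_close_grid_points (N + 1)
      (fun x : ι → ℕ => c fun i => (x i : ℝ) / ((N : ℝ) + 1))
    refine ⟨fun i => (p i : ℝ) / ((N : ℝ) + 1), ⟨fun i => by positivity, ?_⟩, fun i => ?_⟩
    · rw [← Finset.sum_div, div_eq_one_iff_eq hN.ne']
      exact_mod_cast hp
    · rcases h i with h | ⟨q, -, hq, hclose⟩
      · left
        have h' : (p i : ℝ) ≤ K := by rw [hK0]; exact_mod_cast h
        exact div_le_div_of_nonneg_right h' hN.le
      · refine Or.inr ⟨fun i => (q i : ℝ) / ((N : ℝ) + 1), fun j => ?_, fun j => ?_⟩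
        · rw [← hq]
          exact hc _ j
        · rw [← sub_div, abs_div, abs_of_pos hN]
          gcongr
          have h1 : (q j : ℝ) ≤ p j + K := by rw [hK0]; exact_mod_cast (hclose j).1
          have h2 : (p j : ℝ) ≤ q j + K := by rw [hK0]; exact_mod_cast (hclose j).2
          rw [abs_le]
          constructor <;> linarith
  choose p hpmem hp using key
  obtain ⟨z, hz, φ, hφ, hlim⟩ := (isCompact_stdSimplex ℝ ι).tendsto_subseq hpmem
  have hK : Tendsto (fun N : ℕ => K / ((φ N : ℝ) + 1)) atTop (𝓝 0) := by
    have h : Tendsto (fun N : ℕ => K / ((N : ℝ) + 1)) atTop (𝓝 0) :=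
      Tendsto.div_atTop tendsto_const_nhds
        (tendsto_atTop_add_const_right _ _ tendsto_natCast_atTop_atTop)
    exact h.comp hφ.tendsto_atTop
  refine ⟨z, hz, fun i hi j => ?_⟩
  have hlimi : ∀ k, Tendsto (fun N => p (φ N) k) atTop (𝓝 (z k)) := tendsto_pi_nhds.1 hlim
  have hev : ∀ᶠ N in atTop, ∃ q : ι → ℝ, (∀ j, H i q ≤ H j q) ∧
      ∀ j, |q j - p (φ N) j| ≤ K / ((φ N : ℝ) + 1) := by
    filter_upwards [hK.eventually_lt (hlimi i) hi] with N hN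
    exact (hp (φ N) i).resolve_left (not_le.2 hN)
  obtain ⟨q, hq⟩ := hev.choice
  have hqlim : Tendsto q atTop (𝓝 z) := by
    refine tendsto_pi_nhds.2 fun k => ?_
    have h0 : Tendsto (fun N => q N k - p (φ N) k) atTop (𝓝 0) :=
      squeeze_zero_norm' (hq.mono fun N hN => by simpa using hN.2 k) hK
    simpa using h0.add (hlimi k)
  exact le_of_tendsto_of_tendsto (((hH i).tendsto z).comp hqlim) (((hH j).tendsto z).comp hqlim)
    (hq.mono fun N hN => hN.1 j)

/-- Two-player form: mixed strategies supported on minimisers of the opponent's continuous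
cost functions. -/
theorem exists_mem_stdSimplex_mutual_minimizers {α β : Type*} [Fintype α] [Fintype β] [Nonempty α]
    [Nonempty β] (f : α → (β → ℝ) → ℝ) (g : β → (α → ℝ) → ℝ) (hf : ∀ i, Continuous (f i))
    (hg : ∀ j, Continuous (g j)) :
    ∃ u ∈ stdSimplex ℝ α, ∃ v ∈ stdSimplex ℝ β,
      (∀ i, 0 < u i → ∀ i', f i v ≤ f i' v) ∧ (∀ j, 0 < v j → ∀ j', g j u ≤ g j' u) := by
  let x : (α ⊕ β → ℝ) → α → ℝ := fun z i => 2 * z (Sum.inl i)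
  let y : (α ⊕ β → ℝ) → β → ℝ := fun z j => 2 * z (Sum.inr j)
  let F : (β → ℝ) → ℝ := fun v => univ.inf' univ_nonempty fun i => f i v
  let G : (α → ℝ) → ℝ := fun u => univ.inf' univ_nonempty fun j => g j u
  have hF : Continuous F := Continuous.finset_inf'_apply _ fun i _ => hf i
  have hG : Continuous G := Continuous.finset_inf'_apply _ fun j _ => hg j
  have hx : Continuous x := by fun_prop
  have hy : Continuous y := by fun_prop
  have hFle : ∀ v i, F v ≤ f i v := fun v i => inf'_le _ (mem_univ i)
  have hGle : ∀ u j, G u ≤ g j u := fun u j => inf'_le _ (mem_univ j)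
  have hFeq : ∀ v, ∃ i, F v = f i v := fun v => by
    obtain ⟨i, -, h⟩ := exists_mem_eq_inf' univ_nonempty fun i => f i v
    exact ⟨i, h⟩
  have hGeq : ∀ u, ∃ j, G u = g j u := fun u => by
    obtain ⟨j, -, h⟩ := exists_mem_eq_inf' univ_nonempty fun j => g j u
    exact ⟨j, h⟩
  -- The penalty `D` forces both blocks to carry the same mass.
  let D : (α ⊕ β → ℝ) → ℝ := fun z => ∑ i, x z i - ∑ j, y z j
  have hD : Continuous D := by fun_prop
  obtain ⟨z, ⟨hz0, hz1⟩, hz⟩ := exists_mem_stdSimplex_support_minimizes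
    (Sum.elim (fun i z => f i (y z) - F (y z) + D z) (fun j z => g j (x z) - G (x z) - D z))
    (by
      rintro (i | j)
      · exact (((hf i).comp hy).sub (hF.comp hy)).add hD
      · exact (((hg j).comp hx).sub (hG.comp hx)).sub hD)
  rw [Fintype.sum_sum_type] at hz1
  have hx1 : ∑ i, x z i = 2 * ∑ i, z (Sum.inl i) := (mul_sum _ _ _).symm
  have hy1 : ∑ j, y z j = 2 * ∑ j, z (Sum.inr j) := (mul_sum _ _ _).symm
  have hx0 : ∀ i, 0 ≤ x z i := fun i => mul_nonneg zero_le_two (hz0 _)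
  have hy0 : ∀ j, 0 ≤ y z j := fun j => mul_nonneg zero_le_two (hz0 _)
  obtain ⟨i₀, hi₀⟩ := hFeq (y z)
  obtain ⟨j₀, hj₀⟩ := hGeq (x z)
  have hD0 : D z = 0 := by
    refine le_antisymm ?_ ?_
    · by_contra! hpos
      obtain ⟨i, -, hi⟩ : ∃ i ∈ univ, 0 < z (Sum.inl i) := by
        refine Finset.exists_lt_of_sum_lt (f := fun _ => (0 : ℝ)) ?_
        have : D z = ∑ i, x z i - ∑ j, y z j := rfl
        rw [sum_const_zero]
        linarith
      have h := hz _ hi (Sum.inr j₀)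
      simp only [Sum.elim_inl, Sum.elim_inr] at h
      linarith [hFle (y z) i]
    · by_contra! hneg
      obtain ⟨j, -, hj⟩ : ∃ j ∈ univ, 0 < z (Sum.inr j) := by
        refine Finset.exists_lt_of_sum_lt (f := fun _ => (0 : ℝ)) ?_
        have : D z = ∑ i, x z i - ∑ j, y z j := rfl
        rw [sum_const_zero]
        linarith
      have h := hz _ hj (Sum.inl i₀)
      simp only [Sum.elim_inl, Sum.elim_inr] at h
      linarith [hGle (x z) j]
  have hD1 : D z = ∑ i, x z i - ∑ j, y z j := rfl
  refine ⟨x z, ⟨hx0, by linarith⟩, y z, ⟨hy0, by linarith⟩, fun i hi i' => ?_, fun j hj j' => ?_⟩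
  · have h := hz (Sum.inl i) (pos_of_mul_pos_right hi zero_le_two) (Sum.inl i₀)
    simp only [Sum.elim_inl] at h
    linarith [hFle (y z) i']
  · have h := hz (Sum.inr j) (pos_of_mul_pos_right hj zero_le_two) (Sum.inr j₀)
    simp only [Sum.elim_inr] at h
    linarith [hGle (x z) j']

/-- Given nonempty closed sets `Ĉ j ⊆ Δ(m)` (for `j < n`) and
`R̂ i ⊆ Δ(n)` (for `i < m`), the Voronoi approximate best response correspondence has a
fixed point: there are `(u*, v*) ∈ Δ(m) × Δ(n)` such that every index in the support of
`u*` minimises the distance from `v*` to the sets `R̂`, and every index in the support of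
`v*` minimises the distance from `u*` to the sets `Ĉ`. -/
theorem voronoi_correspondence_fixed_point (m n : ℕ) (hm : 1 ≤ m) (hn : 1 ≤ n)
    (C : Fin n → Set (EuclideanSpace ℝ (Fin m)))
    (R : Fin m → Set (EuclideanSpace ℝ (Fin n)))
    (hCne : ∀ j, (C j).Nonempty) (hCcl : ∀ j, IsClosed (C j))
    (hCsub : ∀ j, C j ⊆ probSimplex m)
    (hRne : ∀ i, (R i).Nonempty) (hRcl : ∀ i, IsClosed (R i))
    (hRsub : ∀ i, R i ⊆ probSimplex n) :
    ∃ u ∈ probSimplex m, ∃ v ∈ probSimplex n,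
      (∀ i, 0 < u i → ∀ i', Metric.infDist v (R i) ≤ Metric.infDist v (R i')) ∧
      (∀ j, 0 < v j → ∀ j', Metric.infDist u (C j) ≤ Metric.infDist u (C j')) := by
  have : Nonempty (Fin m) := ⟨⟨0, hm⟩⟩
  have : Nonempty (Fin n) := ⟨⟨0, hn⟩⟩
  obtain ⟨u, hu, v, hv, h₁, h₂⟩ := exists_mem_stdSimplex_mutual_minimizers
    (fun i v => Metric.infDist (WithLp.toLp 2 v) (R i))
    (fun j u => Metric.infDist (WithLp.toLp 2 u) (C j))
    (fun i => (Metric.continuous_infDist_pt (R i)).comp (PiLp.continuous_toLp 2 _))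
    (fun j => (Metric.continuous_infDist_pt (C j)).comp (PiLp.continuous_toLp 2 _))
  exact ⟨WithLp.toLp 2 u, hu, WithLp.toLp 2 v, hv, h₁, h₂⟩
end

section
/- Let m ≥ 2, n ≥ 1, B ∈ [0,1]^{m×n}, and for u ∈ Δ^{m-1} = {x ∈ ℝ^{m-1} : x_i ≥ 0, Σ x_i ≤ 1} let U^j_c(u) = Σ_{i=0}^{m-1} u'_i B_{ij}, where u' = (1 − Σ_i u_i, u_1, ..., u_{m-1}). Let C_j = {u ∈ Δ^{m-1} : U^j_c(u) = max_k U^k_c(u)} be the best response region of column j. Fix ε > 0 and δ = ε/(2√(m−1)). Suppose for each j, Ĉ_j is a compact subset of C_j, and that the union ⋃_j Ĉ_j is a δ-net of Δ^{m-1} in the Euclidean norm (every point of Δ^{m-1} is within Euclidean distance δ of ⋃_j Ĉ_j). Then for every u ∈ Δ^{m-1} and every j such that Ĉ_j is nonempty and dist(u, Ĉ_j) ≤ dist(u, Ĉ_{j'}) for every j' with Ĉ_{j'} nonempty, it holds that U^j_c(u) ≥ max_k U^k_c(u) − ε; that is, Voronoi best responses are ε-best responses. -/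
/-- The utility of a fixed column is `√m`-Lipschitz in the Euclidean norm when the payoffs
lie in `[0,1]`. -/
theorem colUtil_sub_le (m n : ℕ) (B : Matrix (Fin (m + 1)) (Fin n) ℝ)
    (hB : ∀ i j, B i j ∈ Set.Icc (0 : ℝ) 1) (j : Fin n) (u p : EuclideanSpace ℝ (Fin m)) :
    colUtil m n B j u - colUtil m n B j p ≤ Real.sqrt m * dist u p := by
  have hdiff : colUtil m n B j u - colUtil m n B j p =
      ∑ i : Fin m, (u i - p i) * (B i.succ j - B 0 j) := by
    simp only [colUtil, mul_sub, sub_mul, Finset.sum_sub_distrib, ← Finset.sum_mul]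
    ring
  have habs : ∑ i : Fin m, (u i - p i) * (B i.succ j - B 0 j) ≤ ∑ i : Fin m, |u i - p i| := by
    refine Finset.sum_le_sum fun i _ => (le_abs_self _).trans ?_
    rw [abs_mul]
    refine mul_le_of_le_one_right (abs_nonneg _) (abs_le.mpr ?_)
    have h₁ := hB i.succ j
    have h₀ := hB 0 j
    constructor <;> linarith [h₁.1, h₁.2, h₀.1, h₀.2]
  have hcs : ∑ i : Fin m, |u i - p i| ≤ Real.sqrt m * dist u p := by
    rw [EuclideanSpace.dist_eq, ← Real.sqrt_mul (Nat.cast_nonneg m)]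
    apply Real.le_sqrt_of_sq_le
    simpa [Real.dist_eq] using
      sq_sum_le_card_mul_sum_sq (s := Finset.univ) (f := fun i : Fin m => |u i - p i|)
  exact hdiff.trans_le (habs.trans hcs)

/-- Voronoi best responses are `ε`-best responses. With `m + 1 ≥ 2` rows,
column payoffs in `[0,1]`, `δ = ε/(2√m)`, compact sets `Ĉ j` contained in the best
response region `C j` of column `j`, whose union is a `δ`-net of `Δ^m`: for every
`u ∈ Δ^m` and every `j` with `Ĉ j` nonempty minimising the distance `dist(u, Ĉ j)` among
indices with nonempty `Ĉ`, column `j` is an `ε`-best response to `u`. -/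
theorem voronoi_best_responses_are_eps_best (m n : ℕ) (hm : 1 ≤ m) (hn : 1 ≤ n)
    (B : Matrix (Fin (m + 1)) (Fin n) ℝ) (hB : ∀ i j, B i j ∈ Set.Icc (0 : ℝ) 1)
    (ε : ℝ) (hε : 0 < ε)
    (Chat : Fin n → Set (EuclideanSpace ℝ (Fin m)))
    (hCcompact : ∀ j, IsCompact (Chat j))
    (hCsub : ∀ j, Chat j ⊆
      {u ∈ unitSimplex m | ∀ k, colUtil m n B k u ≤ colUtil m n B j u})
    (hnet : ∀ u ∈ unitSimplex m, ∃ j, ∃ p ∈ Chat j,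
      dist u p ≤ ε / (2 * Real.sqrt m)) :
    ∀ u ∈ unitSimplex m, ∀ j, (Chat j).Nonempty →
      (∀ j', (Chat j').Nonempty →
        Metric.infDist u (Chat j) ≤ Metric.infDist u (Chat j')) →
      ∀ k, colUtil m n B k u - ε ≤ colUtil m n B j u := by
  intro u hu j hj hmin k
  obtain ⟨p, hp, hup⟩ := (hCcompact j).exists_infDist_eq_dist hj u
  obtain ⟨j', q, hq, huq⟩ := hnet u hu
  have hdist : dist u p ≤ ε / (2 * Real.sqrt m) :=
    hup ▸ (hmin j' ⟨q, hq⟩).trans ((Metric.infDist_le_dist_of_mem hq).trans huq)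
  have hsqrt : 0 < Real.sqrt m := Real.sqrt_pos.mpr (by exact_mod_cast hm)
  rw [le_div_iff₀ (by positivity)] at hdist
  have hbest := (hCsub j hp).2 k
  have hk := colUtil_sub_le m n B hB k u p
  have hpu := colUtil_sub_le m n B hB j p u
  rw [dist_comm p u] at hpu
  linarith
end

section
/- Let S be a finite set, k ≥ 1, and let f : (S → {0,...,k−1}) → ℝ satisfy 0 ≤ f(a) ≤ 1 for all a. For a tuple x = (x_j)_{j ∈ S} of probability vectors x_j ∈ Δ(k) = {p ∈ ℝ^k : p_r ≥ 0, Σ_r p_r = 1}, define the multilinear extension F(x) = Σ_{a : S → {0,...,k−1}} ( ∏_{j ∈ S} x_j(a_j) ) · f(a). Then F is 1-Lipschitz with respect to the ℓ1 norm on the product: for all such tuples x, y, |F(x) − F(y)| ≤ Σ_{j ∈ S} Σ_{r=0}^{k−1} |x_j(r) − y_j(r)|. -/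
/-- Changing the `i`-th factor of a product of probability vectors changes the product measure,
in `ℓ1` norm, by exactly the change of that factor. -/
theorem sum_abs_prod_update_sub_prod_update {ι κ : Type*} [Fintype ι] [DecidableEq ι]
    [Fintype κ] (p : ι → κ → ℝ) (hp : ∀ j, p j ∈ stdSimplex ℝ κ) (i : ι) (u v : κ → ℝ) :
    ∑ a : ι → κ, |(∏ j, Function.update p i u j (a j)) - ∏ j, Function.update p i v j (a j)| =
      ∑ r, |u r - v r| := by
  have prod_update (w : κ → ℝ) (a : ι → κ) :
      ∏ j, Function.update p i w j (a j) = w (a i) * ∏ j ∈ {i}ᶜ, p j (a j) := by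
    rw [Fintype.prod_eq_mul_prod_compl i, Function.update_self]
    congr 1
    refine Finset.prod_congr rfl fun j hj => ?_
    rw [Function.update_of_ne (by simpa using hj)]
  have abs_sub_eq (a : ι → κ) :
      |(∏ j, Function.update p i u j (a j)) - ∏ j, Function.update p i v j (a j)| =
        ∏ j, Function.update p i (fun r => |u r - v r|) j (a j) := by
    rw [prod_update, prod_update, prod_update, ← sub_mul, abs_mul,
      abs_of_nonneg (Finset.prod_nonneg fun j _ => (hp j).1 (a j))]
  simp_rw [abs_sub_eq]
  rw [← Fintype.prod_sum, Fintype.prod_eq_mul_prod_compl i, Function.update_self,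
    Finset.prod_eq_one, mul_one]
  intro j hj
  rw [Function.update_of_ne (by simpa using hj)]
  exact (hp j).2

/-- The `ℓ1` distance of two product measures is at most the sum of the `ℓ1` distances of
their factors. -/
theorem sum_abs_prod_sub_prod_le {ι κ : Type*} [Fintype ι] [DecidableEq ι] [Fintype κ]
    (x y : ι → κ → ℝ) (hx : ∀ j, x j ∈ stdSimplex ℝ κ) (hy : ∀ j, y j ∈ stdSimplex ℝ κ) :
    ∑ a : ι → κ, |(∏ j, x j (a j)) - ∏ j, y j (a j)| ≤ ∑ j, ∑ r, |x j r - y j r| := by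
  suffices h : ∀ T : Finset ι,
      ∑ a : ι → κ, |(∏ j, T.piecewise x y j (a j)) - ∏ j, y j (a j)| ≤
        ∑ j ∈ T, ∑ r, |x j r - y j r| by
    simpa using h Finset.univ
  intro T
  induction T using Finset.induction_on with
  | empty => simp
  | insert i T hi ih =>
    have hz (j : ι) : T.piecewise x y j ∈ stdSimplex ℝ κ :=
      T.piecewise_cases x y (· ∈ stdSimplex ℝ κ) (hx j) (hy j)
    have step := sum_abs_prod_update_sub_prod_update (T.piecewise x y) hz i (x i) (y i)
    have update_eq : Function.update (T.piecewise x y) i (y i) = T.piecewise x y := by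
      rw [Function.update_eq_self_iff, Finset.piecewise_eq_of_notMem _ _ _ hi]
    rw [update_eq] at step
    rw [Finset.sum_insert hi, Finset.piecewise_insert, ← step]
    refine le_trans ?_ (add_le_add_right ih _)
    rw [← Finset.sum_add_distrib]
    exact Finset.sum_le_sum fun a _ => abs_sub_le _ _ _

/-- The multilinear (expected utility) extension
`F(x) = ∑_a (∏_j x j (a j)) · f a` of a `[0,1]`-valued utility `f` on pure strategy
profiles is `1`-Lipschitz in the `ℓ1` norm on tuples of mixed strategies. -/
theorem multilinear_extension_l1_lipschitz
    (S : Type) [Fintype S] [DecidableEq S] (k : ℕ) (hk : 1 ≤ k)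
    (f : (S → Fin k) → ℝ) (hf : ∀ a, f a ∈ Set.Icc (0 : ℝ) 1)
    (x y : S → Fin k → ℝ)
    (hx : ∀ j, x j ∈ stdSimplex ℝ (Fin k))
    (hy : ∀ j, y j ∈ stdSimplex ℝ (Fin k)) :
    |(∑ a : S → Fin k, (∏ j, x j (a j)) * f a) -
        ∑ a : S → Fin k, (∏ j, y j (a j)) * f a| ≤
      ∑ j, ∑ r, |x j r - y j r| := by
  rw [← Finset.sum_sub_distrib]
  refine (Finset.abs_sum_le_sum_abs _ _).trans
    (le_trans (Finset.sum_le_sum fun a _ => ?_) (sum_abs_prod_sub_prod_le x y hx hy))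
  rw [← sub_mul, abs_mul, abs_of_nonneg (hf a).1]
  exact mul_le_of_le_one_right (abs_nonneg _) (hf a).2
end
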